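/- Let n ≥ 1, let Y be a connected, non-compact, Hausdorff topological manifold modelled on ℝ^n, let f : S^n → Y be a continuous map, and let 0 < δ ≤ π. Then there exist points x, y ∈ S^n with geodesic distance exactly δ (i.e. arccos⟪x,y⟫ = δ) such that f(x) = f(y). -/

import Mathlib

open scoped RealInnerProductSpace

namespace CD

/-- mod 2 chains on lists -/
abbrev Ch (V : Type*) := List V →₀ ZMod 2

noncomputable section

variable {V W X : Type*}

/-- basic chain -/
abbrev bs (l : List V) : Ch V := Finsupp.single l 1

abbrev Sup (S : Set (List V)) : Submodule (ZMod 2) (Ch V) := Finsupp.supported (ZMod 2) (ZMod 2) S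

/-- linear extension -/
abbrev lin {M : Type*} [AddCommMonoid M] [Module (ZMod 2) M] (f : List V → M) : Ch V →ₗ[ZMod 2] M :=
  Finsupp.linearCombination (ZMod 2) f

theorem lin_bs {M : Type*} [AddCommMonoid M] [Module (ZMod 2) M] (f : List V → M) (l : List V) :
    lin f (bs l) = f l := by simp [lin, bs]

theorem bs_mem {S : Set (List V)} {l : List V} (h : l ∈ S) : bs l ∈ Sup S :=
  Finsupp.single_mem_supported _ _ h

theorem sup_ind {S : Set (List V)} {p : Ch V → Prop} (h0 : p 0)
    (hadd : ∀ a b, p a → p b → p (a + b)) (hb : ∀ l ∈ S, p (bs l)) {c : Ch V} (hc : c ∈ Sup S) :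
    p c := by
  rw [Sup, Finsupp.supported_eq_span_single] at hc
  induction hc using Submodule.span_induction with
  | mem x h => obtain ⟨l, hl, rfl⟩ := h; exact hb l hl
  | zero => exact h0
  | add x y _ _ hx hy => exact hadd _ _ hx hy
  | smul a x _ hx =>
    have ha : a = 0 ∨ a = 1 := by revert a; decide
    rcases ha with rfl | rfl
    · rw [zero_smul]; exact h0
    · rw [one_smul]; exact hx

theorem sup_map {S : Set (List V)} {M : Type*} [AddCommGroup M] [Module (ZMod 2) M]
    (L : Ch V →ₗ[ZMod 2] M) (T : Submodule (ZMod 2) M) (h : ∀ l ∈ S, L (bs l) ∈ T) {c : Ch V}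
    (hc : c ∈ Sup S) : L c ∈ T :=
  sup_ind (p := fun c => L c ∈ T) (by simp) (fun a b ha hb => by simpa using T.add_mem ha hb) h hc

theorem sup_eq {S : Set (List V)} {M : Type*} [AddCommGroup M] [Module (ZMod 2) M]
    (L L' : Ch V →ₗ[ZMod 2] M) (h : ∀ l ∈ S, L (bs l) = L' (bs l)) {c : Ch V}
    (hc : c ∈ Sup S) : L c = L' c :=
  sup_ind (p := fun c => L c = L' c) (by simp) (fun a b ha hb => by simp [ha, hb]) h hc

theorem sup_univ (c : Ch V) : c ∈ Sup (Set.univ : Set (List V)) := by simp [Sup, Finsupp.supported_univ]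

theorem sup_supp (c : Ch V) : c ∈ Sup (c.support : Set (List V)) := by
  simp [Sup, Finsupp.mem_supported]

theorem lin_ext {M : Type*} [AddCommGroup M] [Module (ZMod 2) M]
    {L L' : Ch V →ₗ[ZMod 2] M} (h : ∀ l, L (bs l) = L' (bs l)) : L = L' :=
  LinearMap.ext fun c => sup_eq L L' (fun l _ => h l) (sup_univ c)

theorem sup_mono {S T : Set (List V)} (h : S ⊆ T) {c : Ch V} (hc : c ∈ Sup S) : c ∈ Sup T :=
  Finsupp.supported_mono h hc

theorem sup_inter {S T : Set (List V)} {c : Ch V} (hc : c ∈ Sup S) (hc' : c ∈ Sup T) :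
    c ∈ Sup (S ∩ T) := by
  simp only [Sup, Finsupp.mem_supported] at *
  exact Set.subset_inter hc hc'

theorem ch_add_self {M : Type*} [AddCommGroup M] [Module (ZMod 2) M] (c : M) : c + c = 0 :=
  ZModModule.add_self c

def mapc (f : V → W) : Ch V →ₗ[ZMod 2] Ch W := lin fun l => bs (l.map f)

@[simp] theorem mapc_bs (f : V → W) (l : List V) : mapc f (bs l) = bs (l.map f) := lin_bs _ _

def cone (v : V) : Ch V →ₗ[ZMod 2] Ch V := lin fun l => bs (v :: l)

@[simp] theorem cone_bs (v : V) (l : List V) : cone v (bs l) = bs (v :: l) := lin_bs _ _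

def bdL : List V → Ch V
  | [] => 0
  | v :: l => bs l + cone v (bdL l)

def bd : Ch V →ₗ[ZMod 2] Ch V := lin bdL

theorem bd_bs (l : List V) : bd (bs l) = bdL l := lin_bs _ _
@[simp] theorem bd_nil : bd (bs ([] : List V)) = 0 := by rw [bd_bs]; rfl
@[simp] theorem bd_cons (v : V) (l : List V) : bd (bs (v :: l)) = bs l + cone v (bd (bs l)) := by
  simp only [bd_bs]; rfl

theorem bd_cone (v : V) (c : Ch V) : bd (cone v c) = c + cone v (bd c) := by
  have : bd ∘ₗ cone v = LinearMap.id + cone v ∘ₗ bd := lin_ext fun l => by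
    simp only [LinearMap.comp_apply, cone_bs, bd_cons, LinearMap.add_apply, LinearMap.id_apply]
  exact LinearMap.congr_fun this c

theorem bd_bd (c : Ch V) : bd (bd c) = 0 := by
  have : bd ∘ₗ bd = (0 : Ch V →ₗ[ZMod 2] Ch V) := lin_ext fun l => by
    simp only [LinearMap.comp_apply, LinearMap.zero_apply]
    induction l with
    | nil => simp
    | cons v l ih => rw [bd_cons, map_add, bd_cone, ih, map_zero, add_zero, ch_add_self]
  exact LinearMap.congr_fun this c

theorem mapc_cone (f : V → W) (v : V) (c : Ch V) : mapc f (cone v c) = cone (f v) (mapc f c) := by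
  have : mapc f ∘ₗ cone v = cone (f v) ∘ₗ mapc f := lin_ext fun l => by simp
  exact LinearMap.congr_fun this c

theorem mapc_bd (f : V → W) (c : Ch V) : mapc f (bd c) = bd (mapc f c) := by
  have : mapc f ∘ₗ bd = bd ∘ₗ mapc f := lin_ext fun l => by
    simp only [LinearMap.comp_apply]
    induction l with
    | nil => simp
    | cons v l ih => rw [bd_cons, map_add, mapc_cone, ih, mapc_bs, mapc_bs, List.map_cons, bd_cons]
  exact LinearMap.congr_fun this c

theorem mapc_mapc (f : V → W) (g : W → X) (c : Ch V) : mapc g (mapc f c) = mapc (g ∘ f) c := by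
  have : mapc g ∘ₗ mapc f = mapc (g ∘ f) := lin_ext fun l => by simp
  exact LinearMap.congr_fun this c

theorem mapc_congr {S : Set (List V)} {f g : V → W} (h : ∀ l ∈ S, ∀ x ∈ l, f x = g x) {c : Ch V}
    (hc : c ∈ Sup S) : mapc f c = mapc g c :=
  sup_eq _ _ (fun l hl => by simp only [mapc_bs]; rw [List.map_congr_left (h l hl)]) hc

theorem mapc_sup {S : Set (List V)} {T : Set (List W)} {f : V → W} (h : ∀ l ∈ S, l.map f ∈ T) {c : Ch V}
    (hc : c ∈ Sup S) : mapc f c ∈ Sup T :=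
  sup_map _ _ (fun l hl => by rw [mapc_bs]; exact bs_mem (h l hl)) hc

theorem cone_sup {S : Set (List V)} {T : Set (List V)} {v : V} (h : ∀ l ∈ S, v :: l ∈ T) {c : Ch V}
    (hc : c ∈ Sup S) : cone v c ∈ Sup T :=
  sup_map _ _ (fun l hl => by rw [cone_bs]; exact bs_mem (h l hl)) hc

/-- faces -/
def IsFace (l' l : List V) : Prop := l'.Sublist l ∧ l'.length + 1 = l.length

theorem bd_bs_sup (l : List V) : bd (bs l) ∈ Sup {l' | IsFace l' l} := by
  induction l with
  | nil => simp
  | cons v l ih =>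
    rw [bd_cons]
    refine Submodule.add_mem _ (bs_mem ⟨List.sublist_cons_self _ _, by simp⟩) (cone_sup ?_ ih)
    rintro l' ⟨h1, h2⟩
    exact ⟨h1.cons_cons v, by simp [h2]⟩

theorem bd_sup {S T : Set (List V)} (h : ∀ l ∈ S, ∀ l', IsFace l' l → l' ∈ T) {c : Ch V}
    (hc : c ∈ Sup S) : bd c ∈ Sup T :=
  sup_map _ _ (fun l hl => sup_mono (fun l' hl' => h l hl l' hl') (bd_bs_sup l)) hc

/-- prism -/
def prL (a b : V → W) : List V → Ch W
  | [] => 0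
  | v :: l => bs (a v :: b v :: l.map b) + cone (a v) (prL a b l)

def pr (a b : V → W) : Ch V →ₗ[ZMod 2] Ch W := lin (prL a b)

@[simp] theorem pr_nil (a b : V → W) : pr a b (bs []) = 0 := by rw [pr, lin_bs]; rfl
theorem pr_cons (a b : V → W) (v : V) (l : List V) :
    pr a b (bs (v :: l)) = bs (a v :: b v :: l.map b) + cone (a v) (pr a b (bs l)) := by
  simp only [pr, lin_bs]; rfl

theorem pr_cone (a b : V → W) (v : V) (c : Ch V) :
    pr a b (cone v c) = cone (a v) (cone (b v) (mapc b c)) + cone (a v) (pr a b c) := by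
  have : pr a b ∘ₗ cone v = cone (a v) ∘ₗ (cone (b v)) ∘ₗ mapc b + cone (a v) ∘ₗ pr a b :=
    lin_ext fun l => by simp [pr_cons]
  exact LinearMap.congr_fun this c

theorem bd_pr (a b : V → W) (c : Ch V) :
    bd (pr a b c) = mapc a c + mapc b c + pr a b (bd c) := by
  have : bd ∘ₗ pr a b = mapc a + mapc b + pr a b ∘ₗ bd := lin_ext fun l => by
    simp only [LinearMap.comp_apply, LinearMap.add_apply]
    induction l with
    | nil => simp [ch_add_self]
    | cons v l ih =>
      rw [pr_cons, bd_cons, map_add, map_add, pr_cone, bd_cone, ih, bd_cons, bd_cons]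
      simp only [mapc_bs, List.map_cons, map_add, cone_bs, mapc_bd]
      have h1 := ch_add_self (bs (a v :: l.map b))
      have h2 := ch_add_self (pr a b (bs l))
      generalize bs (a v :: l.map b) = x1 at *
      generalize pr a b (bs l) = x2 at *
      generalize cone (a v) ((cone (b v)) (bd (bs (List.map b l)))) = x3 at *
      generalize cone (a v) (pr a b (bd (bs l))) = x4 at *
      generalize bs (b v :: l.map b) = x5 at *
      generalize bs (a v :: l.map a) = x6 at *
      have e : x5 + (x1 + x3) + (x2 + (x6 + x1 + x4)) = (x6 + x5 + (x2 + (x3 + x4))) + (x1 + x1) := by abel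
      rw [e, h1, add_zero]
  exact LinearMap.congr_fun this c

theorem pr_bs_sup (a b : V → W) (l : List V) :
    pr a b (bs l) ∈ Sup {l' | l'.length = l.length + 1 ∧ ∀ x ∈ l', ∃ y ∈ l, x = a y ∨ x = b y} := by
  induction l with
  | nil => simp
  | cons v l ih =>
    rw [pr_cons]
    refine Submodule.add_mem _ (bs_mem ⟨by simp, ?_⟩) (cone_sup ?_ ih)
    · intro x hx
      simp only [List.mem_cons, List.mem_map] at hx ⊢
      rcases hx with rfl | rfl | ⟨y, hy, rfl⟩
      · exact ⟨v, by simp⟩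
      · exact ⟨v, by simp⟩
      · exact ⟨y, by simp [hy]⟩
    · rintro l' ⟨h1, h2⟩
      refine ⟨by simp [h1], ?_⟩
      intro x hx
      simp only [List.mem_cons] at hx ⊢
      rcases hx with rfl | hx
      · exact ⟨v, by simp⟩
      · obtain ⟨y, hy, h⟩ := h2 x hx
        exact ⟨y, by simp [hy], h⟩

theorem pr_sup {S : Set (List V)} {T : Set (List W)} (a b : V → W)
    (h : ∀ l ∈ S, ∀ l' : List W, l'.length = l.length + 1 → (∀ x ∈ l', ∃ y ∈ l, x = a y ∨ x = b y) → l' ∈ T)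
    {c : Ch V} (hc : c ∈ Sup S) : pr a b c ∈ Sup T :=
  sup_map _ _ (fun l hl => sup_mono (fun l' hl' => h l hl l' hl'.1 hl'.2) (pr_bs_sup a b l)) hc

theorem pr_map {V' W' : Type*} (a b : V → W) (a' b' : V' → W') (f : V → V') (g : W → W')
    (ha : ∀ x, g (a x) = a' (f x)) (hb : ∀ x, g (b x) = b' (f x)) (c : Ch V) :
    mapc g (pr a b c) = pr a' b' (mapc f c) := by
  have : mapc g ∘ₗ pr a b = pr a' b' ∘ₗ mapc f := lin_ext fun l => by
    simp only [LinearMap.comp_apply]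
    induction l with
    | nil => simp
    | cons v l ih =>
      have : g ∘ b = b' ∘ f := funext hb
      rw [pr_cons, map_add, mapc_cone, ih]
      simp [pr_cons, ha, hb, this]
  exact LinearMap.congr_fun this c

section cross
variable [AddCommGroup V]

def cross : List V → Ch V
  | [] => bs []
  | e :: l => cone e (cross l) + cone (-e) (cross l)

def half : List V → Ch V
  | [] => bs []
  | e :: l => cone e (cross l)

theorem cross_cons (e : V) (l : List V) : cross (e :: l) = cone e (cross l) + cone (-e) (cross l) := rfl
theorem half_cons (e : V) (l : List V) : half (e :: l) = cone e (cross l) := rfl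

theorem bd_cross (l : List V) : bd (cross l) = 0 := by
  induction l with
  | nil => simp [cross]
  | cons e l ih => rw [cross_cons, map_add, bd_cone, bd_cone, ih]; simp [ch_add_self]

theorem bd_half (e : V) (l : List V) : bd (half (e :: l)) = cross l := by
  rw [half_cons, bd_cone, bd_cross]; simp

theorem neg_cross (l : List V) : mapc (fun x => -x) (cross l) = cross l := by
  induction l with
  | nil => simp [cross]
  | cons e l ih => rw [cross_cons, map_add, mapc_cone, mapc_cone, ih]; simp [add_comm]

theorem cross_eq (e : V) (l : List V) :
    cross (e :: l) = half (e :: l) + mapc (fun x => -x) (half (e :: l)) := by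
  rw [half_cons, mapc_cone, neg_cross, cross_cons]

/-- lists obtained from `l` by sign changes -/
def SignOf (l' l : List V) : Prop := List.Forall₂ (fun x y => x = y ∨ x = -y) l' l

theorem SignOf.cons1 {l' l : List V} (e : V) (h : SignOf l' l) : SignOf (e :: l') (e :: l) :=
  List.Forall₂.cons (Or.inl rfl) h
theorem SignOf.cons2 {l' l : List V} (e : V) (h : SignOf l' l) : SignOf (-e :: l') (e :: l) :=
  List.Forall₂.cons (Or.inr rfl) h

theorem cross_sup (l : List V) : cross l ∈ Sup {l' | SignOf l' l} := by
  induction l with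
  | nil => exact bs_mem List.Forall₂.nil
  | cons e l ih =>
    refine Submodule.add_mem _ (cone_sup ?_ ih) (cone_sup ?_ ih)
    · intro l' hl'
      exact SignOf.cons1 e hl'
    · intro l' hl'
      exact SignOf.cons2 e hl'

theorem half_sup (l : List V) : half l ∈ Sup {l' | SignOf l' l} := by
  cases l with
  | nil => exact bs_mem List.Forall₂.nil
  | cons e l =>
    refine cone_sup ?_ (cross_sup l)
    intro l' hl'
    exact SignOf.cons1 e hl'
end cross

end
end CD

open scoped RealInnerProductSpace

namespace CD
noncomputable section
set_option linter.unusedSectionVars false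

open Filter Topology

theorem face_ind {V : Type*} {P : List V → Prop} (h0 : P [])
    (hs : ∀ v l, (∀ l', IsFace l' (v :: l) → P l') → P (v :: l)) (l : List V) : P l := by
  induction hk : l.length generalizing l with
  | zero => rw [List.length_eq_zero_iff] at hk; rw [hk]; exact h0
  | succ k ih =>
    cases l with
    | nil => exact h0
    | cons v l =>
      refine hs v l fun l' hl' => ih l' ?_
      have := hl'.2
      omega

variable {V W : Type*} [NormedAddCommGroup V] [NormedSpace ℝ V] [NormedAddCommGroup W] [NormedSpace ℝ W]

def conv (l : List V) : Set V := convexHull ℝ {x | x ∈ l}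

theorem mem_conv {l : List V} {x : V} (h : x ∈ l) : x ∈ conv l := subset_convexHull ℝ _ h

theorem conv_sub {l : List V} {K : Set V} (hK : Convex ℝ K) (h : ∀ x ∈ l, x ∈ K) : conv l ⊆ K :=
  convexHull_min (fun x hx => h x hx) hK

theorem conv_convex (l : List V) : Convex ℝ (conv l) := convex_convexHull ℝ _

theorem conv_mono {l l' : List V} (h : ∀ x ∈ l', x ∈ conv l) : conv l' ⊆ conv l :=
  conv_sub (conv_convex l) h

theorem conv_face {l l' : List V} (h : IsFace l' l) : conv l' ⊆ conv l :=
  conv_mono fun _ hx => mem_conv (h.1.subset hx)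

theorem conv_compact (l : List V) : IsCompact (conv l) :=
  Set.Finite.isCompact_convexHull ℝ (List.finite_toSet l)

theorem conv_map (f : V →ᵃ[ℝ] W) (l : List V) : conv (l.map f) = f '' conv l := by
  unfold conv
  rw [AffineMap.image_convexHull]
  congr 1
  ext x; simp

def bary (l : List V) : V := (l.length : ℝ)⁻¹ • l.sum

theorem bary_mem (K : Set V) (hK : Convex ℝ K) (v : V) (l : List V) (h : ∀ x ∈ v :: l, x ∈ K) :
    bary (v :: l) ∈ K := by
  induction l generalizing v with
  | nil => simpa [bary] using h v (by simp)
  | cons w l ih =>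
    have h1 := ih w (fun x hx => h x (List.mem_cons_of_mem _ hx))
    have h2 := h v (by simp)
    have : bary (v :: w :: l) = ((l.length : ℝ) + 2)⁻¹ • v + (((l.length : ℝ) + 1) / (l.length + 2)) • bary (w :: l) := by
      unfold bary
      simp only [List.length_cons, List.sum_cons, smul_smul]
      push_cast
      have e : (l.length : ℝ) + 1 ≠ 0 := by positivity
      have e2 : (l.length : ℝ) + 2 ≠ 0 := by positivity
      rw [smul_add, show ((l.length : ℝ) + 1 + 1) = l.length + 2 by ring]
      congr 2
      field_simp
    rw [this]
    refine hK h2 h1 (by positivity) (by positivity) ?_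
    field_simp; ring

theorem bary_mem_conv (v : V) (l : List V) : bary (v :: l) ∈ conv (v :: l) :=
  bary_mem _ (conv_convex _) v l fun _ hx => mem_conv hx

def Mesh (d : ℝ) (l : List V) : Prop := ∀ x ∈ l, ∀ y ∈ l, dist x y ≤ d

theorem sum_bound (l : List V) (v : V) (d : ℝ) (h : ∀ w ∈ l, dist w v ≤ d) :
    ‖l.sum - (l.length : ℝ) • v‖ ≤ l.length * d := by
  induction l with
  | nil => simp
  | cons w l ih =>
    have h1 := ih (fun w hw => h w (List.mem_cons_of_mem _ hw))
    have h2 := h w (by simp)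
    rw [dist_eq_norm] at h2
    have : (w :: l).sum - ((w :: l).length : ℝ) • v = (w - v) + (l.sum - (l.length : ℝ) • v) := by
      simp [add_smul]; abel
    rw [this]
    refine (norm_add_le _ _).trans ?_
    push_cast [List.length_cons]
    linarith

theorem bary_dist (l : List V) (v : V) (hv : v ∈ l) (d : ℝ) (N : ℕ) (hN : l.length ≤ N + 1)
    (h : Mesh d l) : dist (bary l) v ≤ (N / (N + 1) : ℝ) * d := by
  classical
  have hd : 0 ≤ d := by simpa using h v hv v hv
  have hp := List.perm_cons_erase hv
  have hs := hp.sum_eq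
  have hl := hp.length_eq
  have hb := sum_bound (l.erase v) v d (fun w hw => h w (List.mem_of_mem_erase hw) v hv)
  rw [List.sum_cons] at hs
  rw [List.length_cons] at hl
  set k := (l.erase v).length
  have e : (k : ℝ) + 1 ≠ 0 := by positivity
  have : bary l - v = ((k : ℝ) + 1)⁻¹ • ((l.erase v).sum - (k : ℝ) • v) := by
    unfold bary
    rw [hs, hl]
    push_cast
    rw [smul_add, smul_sub, smul_smul]
    have : v = ((k : ℝ) + 1)⁻¹ • v + (((k : ℝ) + 1)⁻¹ * k) • v := by
      rw [← add_smul]; 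
      rw [show ((k : ℝ) + 1)⁻¹ + ((k : ℝ) + 1)⁻¹ * k = 1 by field_simp; ring, one_smul]
    nth_rewrite 3 [this]
    abel
  rw [dist_eq_norm, this, norm_smul, norm_inv, Real.norm_of_nonneg (by positivity)]
  calc _ ≤ ((k : ℝ) + 1)⁻¹ * (k * d) := by gcongr
    _ = (k / (k + 1)) * d := by field_simp
    _ ≤ _ := by
      refine mul_le_mul_of_nonneg_right ?_ hd
      have : (k : ℝ) ≤ N := by exact_mod_cast (by omega)
      rw [div_le_div_iff₀ (by positivity) (by positivity)]
      nlinarith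

/-- subdivision with fuel -/
def sdF : ℕ → Ch V →ₗ[ZMod 2] Ch V
  | 0 => LinearMap.id
  | k + 1 => lin fun l => cone (bary l) (sdF k (bd (bs l)))

def Sd : Ch V →ₗ[ZMod 2] Ch V := lin fun l => sdF l.length (bs l)

def tF : ℕ → Ch V →ₗ[ZMod 2] Ch V
  | 0 => 0
  | k + 1 => lin fun l => cone (bary l) (bs l + tF k (bd (bs l)))

def Td : Ch V →ₗ[ZMod 2] Ch V := lin fun l => tF l.length (bs l)

@[simp] theorem Sd_nil : Sd (bs ([] : List V)) = bs [] := by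
  rw [Sd, lin_bs]; rfl
@[simp] theorem Td_nil : Td (bs ([] : List V)) = 0 := by
  rw [Td, lin_bs]; rfl

theorem Sd_cons (v : V) (l : List V) :
    Sd (bs (v :: l)) = cone (bary (v :: l)) (Sd (bd (bs (v :: l)))) := by
  rw [Sd, lin_bs, List.length_cons, sdF, lin_bs]
  congr 1
  refine sup_eq _ _ ?_ (bd_bs_sup (v :: l))
  intro l' hl'
  have := hl'.2
  rw [List.length_cons, add_left_inj] at this
  rw [lin_bs, this]

theorem Td_cons (v : V) (l : List V) :
    Td (bs (v :: l)) = cone (bary (v :: l)) (bs (v :: l) + Td (bd (bs (v :: l)))) := by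
  rw [Td, lin_bs, List.length_cons, tF, lin_bs]
  congr 2
  refine sup_eq _ _ ?_ (bd_bs_sup (v :: l))
  intro l' hl'
  have := hl'.2
  rw [List.length_cons, add_left_inj] at this
  rw [lin_bs, this]

theorem bd_Sd (c : Ch V) : bd (Sd c) = Sd (bd c) := by
  have : bd ∘ₗ Sd = Sd ∘ₗ (bd : Ch V →ₗ[ZMod 2] Ch V) := lin_ext fun l => by
    induction l using face_ind with
    | h0 => simp
    | hs v l ih =>
      simp only [LinearMap.comp_apply]
      rw [Sd_cons, bd_cone]
      have : bd (Sd (bd (bs (v :: l)))) = Sd (bd (bd (bs (v :: l)))) :=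
        sup_eq (bd ∘ₗ Sd) (Sd ∘ₗ bd) ih (bd_bs_sup (v :: l))
      rw [this, bd_bd]; simp
  exact LinearMap.congr_fun this c

theorem Td_eq (c : Ch V) : bd (Td c) + Td (bd c) = Sd c + c := by
  have : bd ∘ₗ Td + Td ∘ₗ bd = Sd + (LinearMap.id : Ch V →ₗ[ZMod 2] Ch V) := lin_ext fun l => by
    induction l using face_ind with
    | h0 => simp [ch_add_self]
    | hs v l ih =>
      have := sup_eq _ _ ih (bd_bs_sup (v :: l))
      simp only [LinearMap.comp_apply, LinearMap.add_apply, LinearMap.id_apply] at this ⊢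
      rw [bd_bd, map_zero, add_zero] at this
      rw [Td_cons, bd_cone, map_add, this, Sd_cons]
      simp only [map_add]
      have h1 := ch_add_self (Td (bd (bs (v :: l))))
      have h2 := ch_add_self (cone (bary (v :: l)) (bd (bs (v :: l))))
      generalize (Td (bd (bs (v :: l)))) = x1 at *
      generalize (cone (bary (v :: l)) (bd (bs (v :: l)))) = x2 at *
      generalize (cone (bary (v :: l)) (Sd (bd (bs (v :: l))))) = x3 at *
      generalize bs (v :: l) = x4 at *
      have : x4 + x1 + (x2 + (x3 + x2)) + x1 = x3 + x4 + (x1 + x1) + (x2 + x2) := by abel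
      rw [this, h1, h2]; simp
  exact LinearMap.congr_fun this c

def BaryMap (f : V → W) : Prop := ∀ l : List V, l ≠ [] → f (bary l) = bary (l.map f)

theorem baryMap_affine (f : V →ᵃ[ℝ] W) : BaryMap f := by
  intro l hl
  have hk : (l.length : ℝ) ≠ 0 := by simpa using hl
  have h1 : ∀ l : List V, (l.map f).sum = f.linear l.sum + (l.length : ℝ) • f 0 := by
    intro l
    induction l with
    | nil => simp
    | cons v l ih =>
      rw [List.map_cons, List.sum_cons, ih, List.sum_cons, map_add, AffineMap.decomp' f]
      simp [add_smul]
      abel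
  unfold bary
  rw [h1, smul_add, List.length_map, smul_smul, inv_mul_cancel₀ hk, one_smul]
  have h2 := congrFun (AffineMap.decomp f) ((l.length : ℝ)⁻¹ • l.sum)
  rw [h2]; simp only [Pi.add_apply, map_smul]

theorem mapc_Sd {f : V → W} (hf : BaryMap f) (c : Ch V) : mapc f (Sd c) = Sd (mapc f c) := by
  have : mapc f ∘ₗ Sd = Sd ∘ₗ mapc f := lin_ext fun l => by
    induction l using face_ind with
    | h0 => simp
    | hs v l ih =>
      have := sup_eq _ _ ih (bd_bs_sup (v :: l))
      simp only [LinearMap.comp_apply] at this ⊢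
      rw [Sd_cons, mapc_cone, this, mapc_bd, hf _ (by simp), mapc_bs, List.map_cons, Sd_cons]
  exact LinearMap.congr_fun this c

theorem Sd_bs_sup (l : List V) :
    Sd (bs l) ∈ Sup {l' | l'.length = l.length ∧ ∀ x ∈ l', x ∈ conv l} := by
  induction l using face_ind with
  | h0 => rw [Sd_nil]; exact bs_mem ⟨rfl, by simp⟩
  | hs v l ih =>
    rw [Sd_cons]
    refine cone_sup (S := {l' | l'.length = l.length ∧ ∀ x ∈ l', x ∈ conv (v :: l)}) ?_ ?_
    · rintro l' ⟨h1, h2⟩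
      refine ⟨by simp [h1], ?_⟩
      intro x hx
      rcases List.mem_cons.1 hx with rfl | hx
      · exact bary_mem_conv v l
      · exact h2 x hx
    · refine sup_map _ _ ?_ (bd_bs_sup (v :: l))
      intro l' hl'
      refine sup_mono ?_ (ih l' hl')
      rintro l'' ⟨h1, h2⟩
      refine ⟨?_, fun x hx => conv_face hl' (h2 x hx)⟩
      have := hl'.2
      simp at this
      omega

theorem Td_bs_sup (l : List V) :
    Td (bs l) ∈ Sup {l' | l'.length = l.length + 1 ∧ ∀ x ∈ l', x ∈ conv l} := by
  induction l using face_ind with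
  | h0 => simp
  | hs v l ih =>
    rw [Td_cons]
    refine cone_sup (S := {l' | l'.length = l.length + 1 ∧ ∀ x ∈ l', x ∈ conv (v :: l)}) ?_ ?_
    · rintro l' ⟨h1, h2⟩
      refine ⟨by simp [h1], ?_⟩
      intro x hx
      rcases List.mem_cons.1 hx with rfl | hx
      · exact bary_mem_conv v l
      · exact h2 x hx
    · refine Submodule.add_mem _ (bs_mem ⟨by simp, fun x hx => mem_conv hx⟩) ?_
      refine sup_map _ _ ?_ (bd_bs_sup (v :: l))
      intro l' hl'
      refine sup_mono ?_ (ih l' hl')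
      rintro l'' ⟨h1, h2⟩
      refine ⟨?_, fun x hx => conv_face hl' (h2 x hx)⟩
      have := hl'.2
      simp at this
      omega

theorem Sd_bs_mesh (N : ℕ) (d : ℝ) (hd : 0 ≤ d) (l : List V) (hl : l.length ≤ N + 1) (hm : Mesh d l) :
    Sd (bs l) ∈ Sup {l' | Mesh ((N / (N + 1) : ℝ) * d) l'} := by
  induction l using face_ind with
  | h0 => rw [Sd_nil]; exact bs_mem (by intro x hx; simp at hx)
  | hs v l ih =>
    rw [Sd_cons]
    have h1 : Sd (bd (bs (v :: l))) ∈ Sup {l' | Mesh ((N / (N + 1) : ℝ) * d) l'} := by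
      refine sup_map _ _ ?_ (bd_bs_sup (v :: l))
      intro l' hl'
      refine ih l' hl' ?_ ?_
      · have := hl'.2
        omega
      · intro x hx y hy
        exact hm x (hl'.1.subset hx) y (hl'.1.subset hy)
    have h2 : Sd (bd (bs (v :: l))) ∈ Sup {l' | ∀ x ∈ l', x ∈ conv (v :: l)} := by
      refine sup_map _ _ ?_ (bd_bs_sup (v :: l))
      intro l' hl'
      refine sup_mono ?_ (Sd_bs_sup l')
      exact fun l'' h x hx => conv_face hl' (h.2 x hx)
    refine cone_sup ?_ (sup_inter h1 h2)
    rintro l' ⟨h1, h2⟩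
    have key : ∀ x ∈ l', dist x (bary (v :: l)) ≤ (N / (N + 1) : ℝ) * d := by
      intro x hx
      have : conv (v :: l) ⊆ Metric.closedBall (bary (v :: l)) ((N / (N + 1) : ℝ) * d) := by
        refine conv_sub (convex_closedBall _ _) ?_
        intro y hy
        rw [Metric.mem_closedBall, dist_comm]
        exact bary_dist _ _ hy d N hl hm
      exact this (h2 x hx)
    intro x hx y hy
    rcases List.mem_cons.1 hx with rfl | hx <;> rcases List.mem_cons.1 hy with rfl | hy
    · rw [dist_self]; positivity
    · rw [dist_comm]; exact key y hy
    · exact key x hx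
    · exact h1 x hx y hy

/-- iterated subdivision -/
def SdM (M : ℕ) : Ch V →ₗ[ZMod 2] Ch V := Sd ^ M

@[simp] theorem SdM_zero (c : Ch V) : SdM 0 c = c := by simp [SdM]
theorem SdM_succ (M : ℕ) (c : Ch V) : SdM (M + 1) c = Sd (SdM M c) := by
  simp [SdM, pow_succ']
theorem SdM_add (M N : ℕ) (c : Ch V) : SdM (M + N) c = SdM M (SdM N c) := by
  simp [SdM, pow_add]

theorem SdM_nil (M : ℕ) : SdM M (bs ([] : List V)) = bs [] := by
  induction M with
  | zero => simp
  | succ M ih => rw [SdM_succ, ih, Sd_nil]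

theorem bd_SdM (M : ℕ) (c : Ch V) : bd (SdM M c) = SdM M (bd c) := by
  induction M with
  | zero => simp
  | succ M ih => rw [SdM_succ, bd_Sd, ih, SdM_succ]

theorem mapc_SdM {f : V → W} (hf : BaryMap f) (M : ℕ) (c : Ch V) :
    mapc f (SdM M c) = SdM M (mapc f c) := by
  induction M with
  | zero => simp
  | succ M ih => rw [SdM_succ, mapc_Sd hf, ih, SdM_succ]

/-- `S` is closed under passing to lists of the same length with entries in the convex hull -/
def SdClosed (S : Set (List V)) : Prop :=
  ∀ l ∈ S, ∀ l' : List V, l'.length = l.length → (∀ x ∈ l', x ∈ conv l) → l' ∈ S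

theorem SdM_sup {S : Set (List V)} (hS : SdClosed S) (M : ℕ) {c : Ch V} (hc : c ∈ Sup S) :
    SdM M c ∈ Sup S := by
  induction M with
  | zero => simpa using hc
  | succ M ih =>
    rw [SdM_succ]
    refine sup_map _ _ ?_ ih
    intro l hl
    exact sup_mono (fun l' h => hS l hl l' h.1 h.2) (Sd_bs_sup l)

theorem sdClosed_conv (K : Set V) : SdClosed {l : List V | conv l ⊆ K} :=
  fun _ hl _ _ h => (conv_mono h).trans hl

theorem sdClosed_len (k : ℕ) : SdClosed {l : List V | l.length = k} :=
  fun _ hl _ h _ => h.trans hl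

def TdM : ℕ → Ch V →ₗ[ZMod 2] Ch V
  | 0 => 0
  | M + 1 => Sd ∘ₗ TdM M + Td

theorem TdM_eq (M : ℕ) (c : Ch V) : bd (TdM M c) + TdM M (bd c) = SdM M c + c := by
  induction M with
  | zero => simp [TdM, ch_add_self]
  | succ M ih =>
    simp only [TdM, LinearMap.add_apply, LinearMap.comp_apply, map_add, bd_Sd]
    have h1 := Td_eq c
    have h2 := congrArg Sd ih
    rw [map_add, map_add, ← SdM_succ] at h2
    have h3 := ch_add_self (Sd c)
    calc _ = (Sd (bd (TdM M c)) + Sd (TdM M (bd c))) + (bd (Td c) + Td (bd c)) := by abel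
      _ = _ := by
        rw [h1, h2]
        calc _ = SdM (M + 1) c + c + (Sd c + Sd c) := by abel
          _ = _ := by rw [h3, add_zero]

theorem TdM_bs_sup (M : ℕ) (l : List V) :
    TdM M (bs l) ∈ Sup {l' | l'.length = l.length + 1 ∧ ∀ x ∈ l', x ∈ conv l} := by
  induction M with
  | zero => simp [TdM]
  | succ M ih =>
    simp only [TdM, LinearMap.add_apply, LinearMap.comp_apply]
    refine Submodule.add_mem _ ?_ (Td_bs_sup l)
    refine sup_map _ _ ?_ ih
    rintro l' ⟨h1, h2⟩
    refine sup_mono ?_ (Sd_bs_sup l')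
    exact fun l'' h => ⟨h.1.trans h1, fun x hx => conv_mono h2 (h.2 x hx)⟩

theorem TdM_sup {S T : Set (List V)} (M : ℕ)
    (h : ∀ l ∈ S, ∀ l' : List V, l'.length = l.length + 1 → (∀ x ∈ l', x ∈ conv l) → l' ∈ T)
    {c : Ch V} (hc : c ∈ Sup S) : TdM M c ∈ Sup T :=
  sup_map _ _ (fun l hl => sup_mono (fun l' hl' => h l hl l' hl'.1 hl'.2) (TdM_bs_sup M l)) hc

theorem exists_mesh (l : List V) : ∃ d, 0 ≤ d ∧ Mesh d l := by
  have := (List.finite_toSet l).isBounded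
  obtain ⟨d, hd⟩ := Metric.isBounded_iff.1 this
  refine ⟨max d 0, le_max_right _ _, fun x hx y hy => (hd hx hy).trans (le_max_left _ _)⟩

theorem mesh_conv {d : ℝ} {l : List V} (hd : Mesh d l) {x y : V} (hx : x ∈ conv l) (hy : y ∈ conv l) :
    dist x y ≤ d := by
  have h1 : ∀ z ∈ l, dist x z ≤ d := by
    intro z hz
    have : conv l ⊆ Metric.closedBall z d := conv_sub (convex_closedBall _ _) fun w hw => hd w hw z hz
    exact this hx
  have : conv l ⊆ Metric.closedBall x d := conv_sub (convex_closedBall _ _) fun w hw => by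
    rw [Metric.mem_closedBall, dist_comm]; exact h1 w hw
  have := this hy
  rwa [Metric.mem_closedBall, dist_comm] at this

theorem mesh_ev (c : Ch V) {δ : ℝ} (hδ : 0 < δ) :
    ∀ᶠ M in atTop, SdM M c ∈ Sup {l : List V | Mesh δ l} := by
  refine sup_ind (S := Set.univ) (p := fun c => ∀ᶠ M in atTop, SdM M c ∈ Sup {l : List V | Mesh δ l})
    ?_ ?_ ?_ (sup_univ c)
  · simp
  · intro a b ha hb
    filter_upwards [ha, hb] with M h1 h2
    rw [map_add]; exact Submodule.add_mem _ h1 h2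
  · intro l _
    obtain ⟨d, hd0, hd⟩ := exists_mesh l
    set N := l.length
    set r : ℝ := N / (N + 1)
    have hr : 0 ≤ r := by positivity
    have hr1 : r < 1 := by
      rw [div_lt_one (by positivity)]; linarith
    have key : ∀ M, SdM M (bs l) ∈ Sup {l' | l'.length = N ∧ Mesh (r ^ M * d) l'} := by
      intro M
      induction M with
      | zero => simpa using bs_mem (S := {l' | l'.length = N ∧ Mesh d l'}) ⟨rfl, hd⟩
      | succ M ih =>
        rw [SdM_succ]
        refine sup_map _ _ ?_ ih
        rintro l' ⟨h1, h2⟩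
        refine sup_mono ?_ (sup_inter (Sd_bs_sup l') (Sd_bs_mesh N _ (by positivity) l' (by omega) h2))
        rintro l'' ⟨⟨h3, _⟩, h4⟩
        refine ⟨h3.trans h1, ?_⟩
        rw [pow_succ', mul_assoc]; exact h4
    have ht : Tendsto (fun M : ℕ => r ^ M * d) atTop (𝓝 (0 * d)) :=
      (tendsto_pow_atTop_nhds_zero_of_lt_one hr hr1).mul_const d
    rw [zero_mul] at ht
    filter_upwards [ht.eventually (gt_mem_nhds hδ)] with M hM
    exact sup_mono (fun l' h x hx y hy => (h.2 x hx y hy).trans hM.le) (key M)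

end
end CD

open scoped RealInnerProductSpace

namespace CD
noncomputable section
set_option linter.unusedSectionVars false

open Filter Topology

section general
variable {X V : Type*}

def aug : Ch X →ₗ[ZMod 2] ZMod 2 := Finsupp.lapply []

def cupL (s : X → ZMod 2) (φ : Ch X →ₗ[ZMod 2] ZMod 2) : List X → ZMod 2
  | [] => 0
  | x :: l => s x * φ (bs (x :: l))

def cup (s : X → ZMod 2) (φ : Ch X →ₗ[ZMod 2] ZMod 2) : Ch X →ₗ[ZMod 2] ZMod 2 := lin (cupL s φ)

def Th : List (X → ZMod 2) → (Ch X →ₗ[ZMod 2] ZMod 2)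
  | [] => aug ∘ₗ bd
  | s :: ss => cup s (Th ss) ∘ₗ bd

theorem Th_bd (ss : List (X → ZMod 2)) (c : Ch X) : Th ss (bd c) = 0 := by
  cases ss <;> simp [Th, bd_bd]

theorem Th_nil (ss : List (X → ZMod 2)) : Th ss (bs []) = 0 := by
  cases ss <;> simp [Th]

theorem cup_const {s : X → ZMod 2} {a : ZMod 2} {ss : List (X → ZMod 2)} {c : Ch X}
    (hc : c ∈ Sup {l | ∀ x ∈ l, s x = a}) : cup s (Th ss) c = a * Th ss c := by
  have := sup_eq (cup s (Th ss)) (a • Th ss) ?_ hc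
  · simpa using this
  · intro l hl
    rw [cup, lin_bs]
    cases l with
    | nil => simp [cupL, Th_nil]
    | cons x l => simp [cupL, hl x (by simp)]

theorem Th_const {s : X → ZMod 2} {a : ZMod 2} {ss : List (X → ZMod 2)} (hs : s ∈ ss) {l : List X}
    (hl : ∀ x ∈ l, s x = a) : Th ss (bs l) = 0 := by
  induction ss generalizing l with
  | nil => simp at hs
  | cons s' ss ih =>
    rw [Th, LinearMap.comp_apply]
    rcases List.mem_cons.1 hs with rfl | hs
    · rw [cup_const (a := a), Th_bd, mul_zero]
      refine sup_mono ?_ (bd_bs_sup l)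
      exact fun l' h x hx => hl x (h.1.subset hx)
    · have : ∀ l', IsFace l' l → cup s' (Th ss) (bs l') = (0 : Ch X →ₗ[ZMod 2] ZMod 2) (bs l') := by
        intro l' h
        rw [cup, lin_bs]
        cases l' with
        | nil => simp [cupL]
        | cons x l' =>
          rw [cupL, ih hs (fun x hx => hl x (h.1.subset hx))]; simp
      simpa using sup_eq _ _ this (bd_bs_sup l)

def Anti (σ : X → X) (s : X → ZMod 2) : Prop := ∀ x, s (σ x) = s x + 1

theorem cup_anti {σ : X → X} {s : X → ZMod 2} (hs : Anti σ s) (ss : List (X → ZMod 2))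
    (h : ∀ c, Th ss (mapc σ c) = Th ss c) (c : Ch X) :
    cup s (Th ss) (mapc σ c) = cup s (Th ss) c + Th ss c := by
  have : cup s (Th ss) ∘ₗ mapc σ = cup s (Th ss) + Th ss := lin_ext fun l => by
    simp only [LinearMap.comp_apply, LinearMap.add_apply, mapc_bs, cup, lin_bs]
    cases l with
    | nil => simp [cupL, Th_nil]
    | cons x l =>
      rw [List.map_cons, cupL, cupL, ← List.map_cons, ← mapc_bs, h, hs]; ring
  exact LinearMap.congr_fun this c

theorem Th_anti {σ : X → X} {ss : List (X → ZMod 2)} (hs : ∀ s ∈ ss, Anti σ s) (c : Ch X) :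
    Th ss (mapc σ c) = Th ss c := by
  induction ss generalizing c with
  | nil =>
    rw [Th, LinearMap.comp_apply, LinearMap.comp_apply, ← mapc_bd]
    have : aug ∘ₗ mapc σ = (aug : Ch X →ₗ[ZMod 2] ZMod 2) := lin_ext fun l => by
      simp only [LinearMap.comp_apply, mapc_bs, aug, Finsupp.lapply_apply, bs]
      cases l <;> simp [Finsupp.single_apply]
    exact LinearMap.congr_fun this _
  | cons s ss ih =>
    have h := ih fun s' hs' => hs s' (List.mem_cons_of_mem _ hs')
    rw [Th, LinearMap.comp_apply, LinearMap.comp_apply, ← mapc_bd, cup_anti (hs s (by simp)) ss h,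
      Th_bd, add_zero]

def Hemi (S : Set (List V)) (σ : V → V) : ℕ → Ch V → Prop
  | 0, c => bd c = bs []
  | k + 1, c => ∃ c' ∈ Sup S, Hemi S σ k c' ∧ bd c = c' + mapc σ c'

theorem Th_hemi {σ : X → X} {ss : List (X → ZMod 2)} (hs : ∀ s ∈ ss, Anti σ s) {S : Set (List X)} {c : Ch X}
    (h : Hemi S σ ss.length c) : Th ss c = 1 := by
  induction ss generalizing c with
  | nil =>
    rw [List.length_nil, Hemi] at h
    rw [Th, LinearMap.comp_apply, h]; simp [aug]
  | cons s ss ih =>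
    rw [List.length_cons, Hemi] at h
    obtain ⟨c', _, h1, h2⟩ := h
    have hs' : ∀ s ∈ ss, Anti σ s := fun s' hs' => hs s' (List.mem_cons_of_mem _ hs')
    rw [Th, LinearMap.comp_apply, h2, map_add, cup_anti (hs s (by simp)) ss (Th_anti hs'), ← add_assoc,
      ch_add_self, zero_add, ih hs' h1]

theorem Hemi_map {S : Set (List V)} {σ : V → V} {σ' : X → X} {f : V → X}
    (hf : ∀ l ∈ S, ∀ x ∈ l, f (σ x) = σ' (f x)) {k : ℕ} {c : Ch V} (h : Hemi S σ k c) :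
    Hemi Set.univ σ' k (mapc f c) := by
  induction k generalizing c with
  | zero => rw [Hemi] at h ⊢; rw [← mapc_bd, h]; simp
  | succ k ih =>
    obtain ⟨c', h0, h1, h2⟩ := h
    refine ⟨mapc f c', sup_univ _, ih h1, ?_⟩
    rw [← mapc_bd, h2, map_add, mapc_mapc, mapc_mapc]
    congr 1
    exact mapc_congr (fun l hl x hx => hf l hl x hx) h0

theorem Hemi_mono {S T : Set (List V)} (hST : S ⊆ T) {σ : V → V} {k : ℕ} {c : Ch V} (h : Hemi S σ k c) :
    Hemi T σ k c := by
  induction k generalizing c with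
  | zero => exact h
  | succ k ih =>
    obtain ⟨c', h0, h1, h2⟩ := h
    exact ⟨c', sup_mono hST h0, ih h1, h2⟩

theorem Hemi_SdM [NormedAddCommGroup V] [NormedSpace ℝ V] {S : Set (List V)} {σ : V → V} (hS : SdClosed S)
    (hσ : BaryMap σ) {k : ℕ} {c : Ch V} (h : Hemi S σ k c) (M : ℕ) : Hemi S σ k (SdM M c) := by
  induction k generalizing c with
  | zero => rw [Hemi] at h ⊢; rw [bd_SdM, h, SdM_nil]
  | succ k ih =>
    obtain ⟨c', h0, h1, h2⟩ := h
    exact ⟨SdM M c', SdM_sup hS M h0, ih h1, by rw [bd_SdM, h2, map_add, mapc_SdM hσ]⟩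

theorem Hemi_half [AddCommGroup V] {S : Set (List V)} (es : List V) (e : V)
    (hS : ∀ l l', l.Sublist (e :: es) → l ≠ [] → SignOf l' l → l' ∈ S) :
    Hemi S (fun x => -x) es.length (half (e :: es)) := by
  induction es generalizing e with
  | nil => rw [List.length_nil, Hemi, bd_half]; rfl
  | cons e' es ih =>
    rw [List.length_cons, Hemi]
    refine ⟨half (e' :: es), ?_, ?_, ?_⟩
    · exact sup_mono (fun l' h => hS _ l' (List.sublist_cons_self _ _) (by simp) h) (half_sup _)
    · exact ih e' fun l l' h1 h2 h3 => hS l l' (h1.trans (List.sublist_cons_self _ _)) h2 h3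
    · rw [bd_half, cross_eq]

end general

abbrev Eu (n : ℕ) := EuclideanSpace ℝ (Fin n)
abbrev XX (n : ℕ) := Eu n × ZMod 2

def sgn {n : ℕ} (i : Fin n) (x : XX n) : ZMod 2 :=
  if 0 < x.1 i then 1 else if x.1 i < 0 then 0 else x.2

def sigX {n : ℕ} (x : XX n) : XX n := (-x.1, x.2 + 1)

def sgns (n : ℕ) : List (XX n → ZMod 2) := (List.finRange n).map sgn

theorem sgns_anti (n : ℕ) : ∀ s ∈ sgns n, Anti sigX s := by
  intro s hs
  obtain ⟨i, _, rfl⟩ := List.mem_map.1 hs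
  rintro ⟨w, t⟩
  simp only [sgn, sigX, PiLp.neg_apply, Left.neg_pos_iff, Left.neg_neg_iff]
  rcases lt_trichotomy (w i) 0 with h | h | h
  · simp [h, h.le, not_lt.2 h.le]
  · simp [h]
  · simp [h, h.le, not_lt.2 h.le]; decide

def Theta (n : ℕ) : Ch (XX n) →ₗ[ZMod 2] ZMod 2 := Th (sgns n)

theorem Theta_bd {n : ℕ} (c : Ch (XX n)) : Theta n (bd c) = 0 := Th_bd _ _

theorem Theta_sig {n : ℕ} (c : Ch (XX n)) : Theta n (mapc sigX c) = Theta n c :=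
  Th_anti (sgns_anti n) c

theorem Theta_van {n : ℕ} {η : ℝ} {l : List (XX n)} (h1 : ∀ x ∈ l, ∀ y ∈ l, dist x.1 y.1 ≤ η)
    (h2 : ∀ x ∈ l, n * η < ‖x.1‖) : Theta n (bs l) = 0 := by
  cases l with
  | nil => exact Th_nil _
  | cons x l =>
    have : ∃ i, η < |x.1 i| := by
      by_contra! hc
      have hle : ‖x.1‖ ≤ ∑ i, |x.1 i| := by
        have hx : x.1 = ∑ i, EuclideanSpace.single i (x.1 i) := by
          ext j; simp [Finset.sum_apply]
        calc ‖x.1‖ = ‖∑ i, EuclideanSpace.single i (x.1 i)‖ := by rw [← hx]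
          _ ≤ ∑ i, ‖EuclideanSpace.single i (x.1 i)‖ := norm_sum_le _ _
          _ = _ := by simp
      have := Finset.sum_le_sum (fun i (_ : i ∈ Finset.univ) => hc i)
      simp only [Finset.sum_const, Finset.card_univ, Fintype.card_fin, nsmul_eq_mul] at this
      have h3 := h2 x (by simp)
      linarith
    obtain ⟨i, hi⟩ := this
    have hy : ∀ y ∈ x :: l, |x.1 i - y.1 i| ≤ η := by
      intro y hy
      have h3 := h1 x (by simp) y hy
      rw [dist_eq_norm] at h3
      have := PiLp.norm_apply_le (x.1 - y.1) i
      simp only [PiLp.sub_apply, Real.norm_eq_abs] at this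
      linarith
    have hmem : sgn i ∈ sgns n := List.mem_map.2 ⟨i, List.mem_finRange i, rfl⟩
    rcases lt_abs.1 hi with hp | hp
    · refine Th_const (a := 1) hmem ?_
      intro y hy'
      have := abs_le.1 (hy y hy')
      have : 0 < y.1 i := by linarith
      simp [sgn, this]
    · refine Th_const (a := 0) hmem ?_
      intro y hy'
      have := abs_le.1 (hy y hy')
      have h0 : y.1 i < 0 := by linarith
      simp [sgn, h0, not_lt.2 h0.le]

theorem Theta_van_sup {n : ℕ} {η : ℝ} {c : Ch (XX n)}
    (hc : c ∈ Sup {l | (∀ x ∈ l, ∀ y ∈ l, dist x.1 y.1 ≤ η) ∧ ∀ x ∈ l, n * η < ‖x.1‖}) : Theta n c = 0 := by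
  have := sup_eq (Theta n) 0 (fun l hl => by rw [Theta_van hl.1 hl.2]; rfl) hc
  simpa using this

theorem Theta_hemi {n : ℕ} {V : Type*} {S : Set (List V)} {σ : V → V} {f : V → XX n}
    (hf : ∀ l ∈ S, ∀ x ∈ l, f (σ x) = sigX (f x)) {c : Ch V} (h : Hemi S σ n c) :
    Theta n (mapc f c) = 1 := by
  refine Th_hemi (sgns_anti n) (S := Set.univ) ?_
  have : (sgns n).length = n := by simp [sgns]
  rw [this]
  exact Hemi_map hf h

theorem H1 {n : ℕ} {V : Type*} {f g : V → XX n} {η : ℝ} {c : Ch V}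
    (hc : bd c ∈ Sup {l | (∀ x ∈ l, ∀ y ∈ l, dist (f x).1 (f y).1 ≤ η ∧ dist (f x).1 (g y).1 ≤ η ∧
      dist (g x).1 (g y).1 ≤ η) ∧ ∀ x ∈ l, n * η < ‖(f x).1‖ ∧ n * η < ‖(g x).1‖}) :
    Theta n (mapc f c) = Theta n (mapc g c) := by
  have h := bd_pr f g c
  have h2 := congrArg (Theta n) h
  rw [Theta_bd, map_add, map_add] at h2
  have h3 : Theta n (pr f g (bd c)) = 0 := by
    refine Theta_van_sup (η := η) (pr_sup f g ?_ hc)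
    rintro l ⟨a1, a2⟩ l' _ h
    constructor
    · intro x hx y hy
      obtain ⟨x', hx', rfl | rfl⟩ := h x hx <;> obtain ⟨y', hy', rfl | rfl⟩ := h y hy
      · exact (a1 _ hx' _ hy').1
      · exact (a1 _ hx' _ hy').2.1
      · rw [dist_comm]; exact (a1 _ hy' _ hx').2.1
      · exact (a1 _ hx' _ hy').2.2
    · intro x hx
      obtain ⟨x', hx', rfl | rfl⟩ := h x hx
      · exact (a2 _ hx').1
      · exact (a2 _ hx').2
  rw [h3, add_zero] at h2
  exact (CharTwo.add_eq_zero.1 h2.symm)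

def lab {n : ℕ} {V : Type*} (D : V → Eu n) (u : V → ZMod 2) : V → XX n := fun x => (D x, u x)

theorem unif {n : ℕ} {Z : Type*} [PseudoMetricSpace Z] {K : Set Z} (hK : IsCompact K) {F : Z → Eu n}
    (hF : ContinuousOn F K) (h0 : ∀ x ∈ K, F x ≠ 0) :
    ∃ η > 0, ∃ δ > 0, (∀ x ∈ K, n * η < ‖F x‖) ∧ ∀ x ∈ K, ∀ y ∈ K, dist x y ≤ δ → dist (F x) (F y) ≤ η := by
  have : ∃ m > 0, ∀ x ∈ K, m ≤ ‖F x‖ := by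
    rcases K.eq_empty_or_nonempty with rfl | hne
    · exact ⟨1, one_pos, by simp⟩
    · obtain ⟨x, hx, hm⟩ := hK.exists_isMinOn hne hF.norm
      exact ⟨‖F x‖, norm_pos_iff.2 (h0 x hx), fun y hy => hm hy⟩
  obtain ⟨m, hm, hm'⟩ := this
  have hu := hK.uniformContinuousOn_of_continuous hF
  rw [Metric.uniformContinuousOn_iff] at hu
  obtain ⟨δ, hδ, h⟩ := hu (m / (n + 1)) (by positivity)
  refine ⟨m / (n + 1), by positivity, δ / 2, by positivity, ?_, ?_⟩
  · intro x hx
    refine lt_of_lt_of_le ?_ (hm' x hx)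
    rw [← mul_div_assoc, div_lt_iff₀ (by positivity)]
    nlinarith
  · intro x hx y hy hxy
    exact (h x hx y hy (by linarith)).le

variable {V : Type*} [NormedAddCommGroup V] [NormedSpace ℝ V]

theorem Vlem {n : ℕ} {K : Set V} (hK : IsCompact K) {D : V → Eu n} (hD : ContinuousOn D K)
    (h0 : ∀ x ∈ K, D x ≠ 0) {c : Ch V} (hc : c ∈ Sup {l | conv l ⊆ K}) :
    ∀ᶠ M in atTop, ∀ u, Theta n (mapc (lab D u) (SdM M c)) = 0 := by
  obtain ⟨η, hη, δ, hδ, h1, h2⟩ := unif hK hD h0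
  filter_upwards [mesh_ev c hδ] with M hM u
  refine Theta_van_sup (η := η) (mapc_sup ?_ (sup_inter hM (SdM_sup (sdClosed_conv K) M hc)))
  rintro l ⟨a1, a2⟩
  constructor
  · intro x hx y hy
    obtain ⟨x', hx', rfl⟩ := List.mem_map.1 hx
    obtain ⟨y', hy', rfl⟩ := List.mem_map.1 hy
    exact h2 _ (a2 (mem_conv hx')) _ (a2 (mem_conv hy')) (a1 _ hx' _ hy')
  · intro x hx
    obtain ⟨x', hx', rfl⟩ := List.mem_map.1 hx
    exact h1 _ (a2 (mem_conv hx'))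

theorem Hlem {n : ℕ} {K : Set V} (hK : IsCompact K) {F : ℝ → V → Eu n}
    (hF : ContinuousOn (fun p : ℝ × V => F p.1 p.2) (Set.Icc 0 1 ×ˢ K))
    (h0 : ∀ t ∈ Set.Icc (0:ℝ) 1, ∀ x ∈ K, F t x ≠ 0) {c : Ch V} (hc : bd c ∈ Sup {l | conv l ⊆ K}) :
    ∀ᶠ M in atTop, ∀ u u', Theta n (mapc (lab (F 0) u) (SdM M c)) = Theta n (mapc (lab (F 1) u') (SdM M c)) := by
  obtain ⟨η, hη, δ, hδ, h1, h2⟩ := unif (isCompact_Icc.prod hK) hF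
    (fun p hp => h0 p.1 hp.1 p.2 hp.2)
  obtain ⟨N, hN⟩ := exists_nat_one_div_lt hδ
  filter_upwards [mesh_ev (bd c) hδ] with M hM u u'
  have hs : bd (SdM M c) ∈ Sup ({l | Mesh δ l} ∩ {l | conv l ⊆ K}) := by
    rw [bd_SdM]
    exact sup_inter hM (SdM_sup (sdClosed_conv K) M hc)
  have step : ∀ s ∈ Set.Icc (0:ℝ) 1, ∀ t ∈ Set.Icc (0:ℝ) 1, |s - t| ≤ δ → ∀ u u',
      Theta n (mapc (lab (F s) u) (SdM M c)) = Theta n (mapc (lab (F t) u') (SdM M c)) := by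
    intro s hs' t ht hst u u'
    refine H1 (η := η) (sup_mono ?_ hs)
    rintro l ⟨a1, a2⟩
    have a3 : ∀ x ∈ l, x ∈ K := fun x hx => a2 (mem_conv hx)
    have key : ∀ x ∈ l, ∀ y ∈ l, ∀ s ∈ Set.Icc (0:ℝ) 1, ∀ t ∈ Set.Icc (0:ℝ) 1, |s - t| ≤ δ →
        dist (F s x) (F t y) ≤ η := by
      intro x hx y hy s hs t ht hst
      exact h2 (s, x) ⟨hs, a3 x hx⟩ (t, y) ⟨ht, a3 y hy⟩ (max_le hst (a1 x hx y hy))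
    refine ⟨fun x hx y hy => ⟨?_, ?_, ?_⟩, fun x hx => ⟨?_, ?_⟩⟩
    · exact key x hx y hy s hs' s hs' (by simpa using hδ.le)
    · exact key x hx y hy s hs' t ht hst
    · exact key x hx y hy t ht t ht (by simpa using hδ.le)
    · exact h1 (s, x) ⟨hs', a3 x hx⟩
    · exact h1 (t, x) ⟨ht, a3 x hx⟩
  have hNp : (0:ℝ) < N + 1 := by positivity
  have hmem : ∀ i : ℕ, i ≤ N + 1 → (i / (N + 1) : ℝ) ∈ Set.Icc (0:ℝ) 1 := by
    intro i hi
    refine ⟨by positivity, ?_⟩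
    rw [div_le_one hNp]; exact_mod_cast hi
  have ind : ∀ i : ℕ, i ≤ N + 1 → ∀ u', Theta n (mapc (lab (F 0) u) (SdM M c))
      = Theta n (mapc (lab (F (i / (N + 1))) u') (SdM M c)) := by
    intro i
    induction i with
    | zero =>
      intro _ u'
      simpa using step 0 (by simp) 0 (by simp) (by simpa using hδ.le) u u'
    | succ i ih =>
      intro hi u'
      rw [ih (by omega) u]
      refine step _ (hmem i (by omega)) _ (hmem _ hi) ?_ _ _
      rw [abs_sub_comm, abs_of_nonneg]
      · push_cast
        rw [← sub_div]
        simpa using hN.le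
      · rw [← sub_div]; push_cast; simp; positivity
  have := ind (N + 1) le_rfl u'
  push_cast at this
  rwa [div_self hNp.ne'] at this

theorem exists_u (V : Type*) [AddCommGroup V] [Module ℝ V] : ∃ u : V → ZMod 2, ∀ x, x ≠ 0 → u (-x) = u x + 1 := by
  classical
  refine ⟨fun x => if WellOrderingRel x (-x) then 1 else 0, ?_⟩
  intro x hx
  have hne : x ≠ -x := by
    intro h
    have h2 : (2:ℝ) • x = 0 := by rw [two_smul]; nth_rewrite 2 [h]; simp
    exact hx ((smul_eq_zero.1 h2).resolve_left (by norm_num))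
  simp only [neg_neg]
  rcases trichotomous_of WellOrderingRel x (-x) with h | h | h
  · rw [if_neg (asymm_of WellOrderingRel h), if_pos h]; decide
  · exact absurd h hne
  · rw [if_pos h, if_neg (asymm_of WellOrderingRel h)]; decide

theorem Theta_borsuk {n : ℕ} {c : Ch V} (h : Hemi {l | conv l ⊆ {0}ᶜ} (fun x : V => -x) n c) {D : V → Eu n}
    (hD : ∀ x, D (-x) = - D x) {u : V → ZMod 2} (hu : ∀ x, x ≠ 0 → u (-x) = u x + 1) (M : ℕ) :
    Theta n (mapc (lab D u) (SdM M c)) = 1 := by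
  have hb : BaryMap (fun x : V => -x) := by
    have := baryMap_affine ((-LinearMap.id : V →ₗ[ℝ] V).toAffineMap)
    exact this
  refine Theta_hemi ?_ (Hemi_SdM (sdClosed_conv _) hb h M)
  intro l hl x hx
  simp [lab, sigX, hD, hu x (hl (mem_conv hx))]

end
end CD

open scoped RealInnerProductSpace

namespace CD
noncomputable section
set_option linter.unusedSectionVars false

open Filter Topology

variable {V : Type*} [NormedAddCommGroup V] [NormedSpace ℝ V]

theorem Vlem' {n : ℕ} {D : V → Eu n} {c : Ch V}
    (hc : c ∈ Sup {l | ContinuousOn D (conv l) ∧ ∀ x ∈ conv l, D x ≠ 0}) :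
    ∀ᶠ M in atTop, ∀ u, Theta n (mapc (lab D u) (SdM M c)) = 0 := by
  refine sup_ind (p := fun c => ∀ᶠ M in atTop, ∀ u, Theta n (mapc (lab D u) (SdM M c)) = 0) ?_ ?_ ?_ hc
  · simp
  · intro a b ha hb
    filter_upwards [ha, hb] with M h1 h2 u
    rw [map_add, map_add, map_add, h1, h2, add_zero]
  · rintro l ⟨h1, h2⟩
    exact Vlem (conv_compact l) h1 h2 (bs_mem (S := {l' | conv l' ⊆ conv l}) (fun x hx => hx))

theorem Hlem' {n : ℕ} {A : Set V} {F : ℝ → V → Eu n}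
    (hF : ContinuousOn (fun p : ℝ × V => F p.1 p.2) (Set.Icc 0 1 ×ˢ A)) {c : Ch V}
    (hc : bd c ∈ Sup {l | conv l ⊆ A ∧ ∀ t ∈ Set.Icc (0:ℝ) 1, ∀ x ∈ conv l, F t x ≠ 0}) :
    ∀ᶠ M in atTop, ∀ u u', Theta n (mapc (lab (F 0) u) (SdM M c)) = Theta n (mapc (lab (F 1) u') (SdM M c)) := by
  set K : Set V := ⋃ l ∈ (bd c).support, conv l
  have hK : IsCompact K := (bd c).support.isCompact_biUnion fun l _ => conv_compact l
  rw [Sup, Finsupp.mem_supported] at hc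
  have hKA : K ⊆ A := Set.iUnion₂_subset fun l hl => (hc hl).1
  refine Hlem hK (hF.mono (Set.prod_mono subset_rfl hKA)) ?_ (sup_mono ?_ (sup_supp (bd c)))
  · intro t ht x hx
    obtain ⟨l, hl, hx⟩ := Set.mem_iUnion₂.1 hx
    exact (hc hl).2 t ht x hx
  · intro l hl
    exact Set.subset_biUnion_of_mem (u := fun l => conv l) hl

theorem conv_ofFn {k : ℕ} (w : Fin k → V) {x : V} (hx : x ∈ conv (List.ofFn w)) :
    ∃ μ : Fin k → ℝ, (∀ i, 0 ≤ μ i) ∧ ∑ i, μ i = 1 ∧ ∑ i, μ i • w i = x := by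
  classical
  have h : conv (List.ofFn w) = convexHull ℝ (Set.range w) := by
    unfold conv; congr 1; ext x; simp [List.mem_ofFn]
  rw [h] at hx
  have h1 : Set.range w = (Fintype.linearCombination ℝ w) '' (Set.range fun i j : Fin k => if i = j then (1:ℝ) else 0) := by
    rw [← Set.range_comp]
    congr 1; ext i
    simp [Fintype.linearCombination_apply]
  rw [h1, ← LinearMap.image_convexHull, convexHull_basis_eq_stdSimplex] at hx
  obtain ⟨μ, hμ, rfl⟩ := hx
  exact ⟨μ, hμ.1, hμ.2, rfl⟩

theorem mem_conv_of {k : ℕ} {w : Fin k → V} {l : List V} (μ : Fin k → ℝ) (h0 : ∀ i, 0 ≤ μ i)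
    (h1 : ∑ i, μ i = 1) (hl : ∀ i, μ i ≠ 0 → w i ∈ l) : ∑ i, μ i • w i ∈ conv l := by
  classical
  have h2 : ∑ i, μ i • w i = ∑ i ∈ Finset.univ.filter (fun i => μ i ≠ 0), μ i • w i := by
    rw [Finset.sum_filter]
    refine Finset.sum_congr rfl fun i _ => ?_
    by_cases h : μ i = 0 <;> simp [h]
  rw [h2]
  refine (conv_convex l).sum_mem (fun i _ => h0 i) ?_ ?_
  · rw [← h1, Finset.sum_filter_ne_zero]
  · intro i hi
    exact mem_conv (hl i (Finset.mem_filter.1 hi).2)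

theorem norm_data {n : ℕ} (κ : List (Eu n)) (hlen : κ.length = n + 1) (h0 : (0 : Eu n) ∈ conv κ)
    (hf : ∀ l, IsFace l κ → (0 : Eu n) ∉ conv l) :
    ∃ (w0 : Eu n) (b : Module.Basis (Fin n) ℝ (Eu n)),
      κ = (0 :: (List.finRange n).map b).map (fun x => x + w0) ∧ (∀ i, 0 < b.coord i (-w0)) ∧
      ∑ i, b.coord i (-w0) < 1 := by
  classical
  obtain ⟨w, rfl⟩ : ∃ w : Fin (n + 1) → Eu n, κ = List.ofFn w := by
    refine ⟨fun i => κ.get (i.cast hlen.symm), ?_⟩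
    apply List.ext_get
    · simp [hlen]
    · intro i h1 h2; simp only [List.get_eq_getElem, List.getElem_ofFn, Fin.val_cast]
  obtain ⟨μ, hμ0, hμ1, hμ2⟩ := conv_ofFn w h0
  -- weights with zero entry are impossible
  have key : ∀ ν : Fin (n + 1) → ℝ, (∀ i, 0 ≤ ν i) → ∑ i, ν i = 1 → ∑ i, ν i • w i = 0 → ∀ i, ν i ≠ 0 := by
    intro ν h1 h2 h3 i hi
    have hface : IsFace ((List.ofFn w).eraseIdx i) (List.ofFn w) := by
      refine ⟨List.eraseIdx_sublist _ _, ?_⟩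
      rw [List.length_eraseIdx]; simp only [List.length_ofFn, i.2, if_true]; omega
    refine hf _ hface ?_
    rw [← h3]
    refine mem_conv_of ν h1 h2 ?_
    intro j hj
    rw [List.mem_eraseIdx_iff_getElem]
    refine ⟨j, by rw [List.length_ofFn]; exact j.2, ?_, by simp only [List.getElem_ofFn]⟩
    intro h
    have : j = i := Fin.ext h
    exact hj (this ▸ hi)
  have indep : ∀ c : Fin (n + 1) → ℝ, ∑ i, c i = 0 → ∑ i, c i • w i = 0 → ∀ i, c i ≤ 0 := by
    intro c hc1 hc2
    by_contra! hc
    set P := Finset.univ.filter fun i => 0 < c i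
    have hP : P.Nonempty := by obtain ⟨i, hi⟩ := hc; exact ⟨i, by simp [P, hi]⟩
    obtain ⟨j, hj, hmin⟩ := P.exists_min_image (fun i => μ i / c i) hP
    have hcj : 0 < c j := (Finset.mem_filter.1 hj).2
    set t := μ j / c j
    have ht : 0 ≤ t := div_nonneg (hμ0 j) hcj.le
    refine key (fun i => μ i - t * c i) ?_ ?_ ?_ j ?_
    · intro i
      rcases le_or_gt (c i) 0 with h | h
      · have := hμ0 i
        nlinarith
      · have := hmin i (by simp [P, h])
        rw [le_div_iff₀ h] at this
        linarith
    · rw [Finset.sum_sub_distrib, ← Finset.mul_sum, hc1, hμ1]; simp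
    · simp only [sub_smul, Finset.sum_sub_distrib, mul_smul, ← Finset.smul_sum, hc2, hμ2]; simp
    · simp only [t]; field_simp; simp
  set ξ : Fin n → Eu n := fun i => w i.succ - w 0
  have hli : LinearIndependent ℝ ξ := by
    rw [Fintype.linearIndependent_iff]
    intro g hg
    have hc : ∀ g : Fin n → ℝ, ∑ i, g i • ξ i = 0 → ∀ i, g i ≤ 0 := by
      intro g hg i
      have := indep (Fin.cons (-∑ i, g i) g) (by simp [Fin.sum_univ_succ]) ?_ i.succ
      · simpa using this
      · rw [Fin.sum_univ_succ]
        simp only [Fin.cons_zero, Fin.cons_succ]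
        rw [← hg]
        simp only [ξ, smul_sub, Finset.sum_sub_distrib, neg_smul, Finset.sum_smul]
        abel
    intro i
    have h1 := hc g hg i
    have h2 := hc (fun i => - g i) (by simp [hg]) i
    linarith
  let b := basisOfLinearIndependentOfCardEqFinrank' ξ hli (by simp)
  have hb : ∀ i, b i = ξ i := fun i => by simp [b]
  have hw : -(w 0) = ∑ i : Fin n, μ i.succ • b i := by
    have h1 := hμ2
    have h2 := hμ1
    rw [Fin.sum_univ_succ] at h1 h2
    simp only [hb, ξ, smul_sub, Finset.sum_sub_distrib, ← Finset.sum_smul]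
    have h3 : ∑ i : Fin n, μ i.succ • w i.succ = - (μ 0 • w 0) := by rw [eq_neg_iff_add_eq_zero, add_comm]; exact h1
    have h4 : ∑ i : Fin n, μ i.succ = 1 - μ 0 := by linarith
    rw [h3, h4, sub_smul, one_smul]; abel
  have hcoord : ∀ i, b.coord i (-(w 0)) = μ i.succ := by
    intro i
    rw [hw]
    simp [Finsupp.single_apply]
  have hpos : ∀ i, 0 < μ i := fun i => lt_of_le_of_ne (hμ0 i) (key μ hμ0 hμ1 hμ2 i).symm
  refine ⟨w 0, b, ?_, ?_, ?_⟩
  · rw [List.ofFn_succ, List.map_cons, zero_add, List.map_map]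
    congr 1
    rw [List.ofFn_eq_map]
    refine List.map_congr_left fun i _ => ?_
    simp [hb, ξ]
  · intro i; rw [hcoord]; exact hpos _
  · simp only [hcoord]
    have h2 := hμ1
    rw [Fin.sum_univ_succ] at h2
    have := hpos 0
    linarith

section signs
variable {ι : Type*} {E : Type*} [NormedAddCommGroup E] [NormedSpace ℝ E] (b : Module.Basis ι ℝ E)

theorem signOf_mem {E : Type*} [AddCommGroup E] {l' l : List E} (h : SignOf l' l) : ∀ x ∈ l', ∃ y ∈ l, x = y ∨ x = -y := by
  induction h with
  | nil => simp
  | @cons a c l1 l2 h1 _ ih =>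
    intro x hx
    rcases List.mem_cons.1 hx with rfl | hx
    · exact ⟨c, by simp, h1⟩
    · obtain ⟨y, hy, h⟩ := ih x hx
      exact ⟨y, by simp [hy], h⟩

theorem signOf_mem' {E : Type*} [AddCommGroup E] {l' l : List E} (h : SignOf l' l) : ∀ y ∈ l, y ∈ l' ∨ -y ∈ l' := by
  induction h with
  | nil => simp
  | @cons a c l1 l2 h1 _ ih =>
    intro y hy
    rcases List.mem_cons.1 hy with rfl | hy
    · rcases h1 with rfl | rfl <;> simp
    · rcases ih y hy with h | h <;> simp [h]

theorem coord_other {is : List ι} {i : ι} (hi : i ∉ is) {l' : List E} (h : SignOf l' (is.map b)) :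
    ∀ x ∈ l', b.coord i x = 0 := by
  intro x hx
  obtain ⟨y, hy, h⟩ := signOf_mem h x hx
  obtain ⟨j, hj, rfl⟩ := List.mem_map.1 hy
  have : j ≠ i := fun h => hi (h ▸ hj)
  rcases h with rfl | rfl <;> simp [Finsupp.single_apply, this]

theorem sign_fun {is : List ι} (hn : is.Nodup) {l' : List E} (h : SignOf l' (is.map b)) :
    ∃ φ : E →ₗ[ℝ] ℝ, ∀ x ∈ l', φ x = 1 := by
  induction is generalizing l' with
  | nil =>
    refine ⟨0, ?_⟩
    cases h; simp
  | cons i is ih =>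
    rw [List.nodup_cons] at hn
    rw [List.map_cons] at h
    cases h with
    | @cons a _ l1 _ h1 h2 =>
      obtain ⟨φ, hφ⟩ := ih hn.2 h2
      have h3 := coord_other b hn.1 h2
      obtain ⟨ε, hε, rfl⟩ : ∃ ε : ℝ, ε * ε = 1 ∧ a = ε • b i := by
        rcases h1 with rfl | rfl
        · exact ⟨1, by simp⟩
        · exact ⟨-1, by simp⟩
      refine ⟨φ + (ε - φ (b i)) • b.coord i, ?_⟩
      intro x hx
      rcases List.mem_cons.1 hx with rfl | hx
      · simp; linear_combination hε
      · simp only [LinearMap.add_apply, LinearMap.smul_apply, h3 x hx, hφ x hx]; simp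

def rest {E : Type*} [AddCommGroup E] : List E → Ch E
  | [] => 0
  | e :: l => cone e (rest l) + cone (-e) (cross l)

theorem cross_rest {E : Type*} [AddCommGroup E] (l : List E) : cross l = bs l + rest l := by
  induction l with
  | nil => simp [cross, rest]
  | cons e l ih =>
    rw [cross_cons, rest]
    nth_rewrite 1 [ih]
    rw [map_add, cone_bs, add_assoc]

theorem rest_sup {is : List ι} (hn : is.Nodup) :
    rest (is.map b) ∈ Sup {l' | ∃ i ∈ is, ∀ x ∈ l', b.coord i x ≤ 0} := by
  induction is with
  | nil => simp [rest]
  | cons i is ih =>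
    rw [List.nodup_cons] at hn
    rw [List.map_cons, rest]
    refine Submodule.add_mem _ (cone_sup ?_ (ih hn.2)) (cone_sup ?_ (cross_sup _))
    · rintro l' ⟨j, hj, h⟩
      refine ⟨j, by simp [hj], ?_⟩
      have : i ≠ j := fun h => hn.1 (h ▸ hj)
      intro x hx
      rcases List.mem_cons.1 hx with rfl | hx
      · simp [Finsupp.single_apply, this]
      · exact h x hx
    · intro l' h
      refine ⟨i, by simp, ?_⟩
      intro x hx
      rcases List.mem_cons.1 hx with rfl | hx
      · simp
      · exact (coord_other b hn.1 h x hx).le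

theorem fun_conv {φ : E →ₗ[ℝ] ℝ} {l : List E} (h : ∀ x ∈ l, φ x = 1) : ∀ x ∈ conv l, φ x = 1 := by
  intro x hx
  have h1 : conv l ⊆ {x | φ x = 1} := conv_sub (convex_hyperplane φ.isLinear 1) h
  exact h1 hx

theorem hemi_basis {is : List ι} (hn : is.Nodup) (i : ι) (hi : i ∉ is) :
    Hemi {l | conv l ⊆ {0}ᶜ} (fun x : E => -x) is.length (half ((i :: is).map b)) := by
  have := Hemi_half (S := {l | conv l ⊆ {0}ᶜ}) (is.map b) (b i) ?_
  · rwa [List.length_map] at this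
  · intro l l' h1 h2 h3
    rw [← List.map_cons, List.sublist_map_iff] at h1
    obtain ⟨js, hjs, rfl⟩ := h1
    obtain ⟨φ, hφ⟩ := sign_fun b (hjs.nodup (List.nodup_cons.2 ⟨hi, hn⟩)) h3
    intro x hx h0
    have := fun_conv hφ x hx
    rw [Set.mem_singleton_iff.1 h0] at this
    simp at this

end signs

theorem Norm {n : ℕ} {O : Eu n → Eu n} (hO : Continuous O) (hodd : ∀ w, O (-w) = - O w)
    (hO0 : ∀ w, O w = 0 → w = 0) (κ : List (Eu n)) (hlen : κ.length = n + 1) (h0 : (0 : Eu n) ∈ conv κ)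
    (hf : ∀ l, IsFace l κ → (0 : Eu n) ∉ conv l) :
    ∀ᶠ M in atTop, ∀ u, Theta n (mapc (lab O u) (SdM M (bs κ))) = 1 := by
  obtain ⟨w0, b, hκ, hpos, hsum⟩ := norm_data κ hlen h0 hf
  set is := List.finRange n with his
  have hnd : is.Nodup := List.nodup_finRange n
  set c : Ch (Eu n) := cone 0 (cross (is.map b)) with hc
  have hbdc : bd c = cross (is.map b) := by rw [hc, bd_cone, bd_cross]; simp
  have hhemi : Hemi {l | conv l ⊆ {0}ᶜ} (fun x : Eu n => -x) n c := by
    have hl : is.length = n := by simp [his]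
    rcases hcs : is with _ | ⟨i, js⟩
    · rw [hcs] at hl hbdc
      simp only [List.length_nil] at hl
      subst hl
      rw [Hemi, hbdc]; rfl
    · rw [hcs] at hl hbdc hnd
      rw [List.nodup_cons] at hnd
      simp only [List.length_cons] at hl
      have hh := hemi_basis b hnd.2 i hnd.1
      suffices h : Hemi {l | conv l ⊆ {0}ᶜ} (fun x : Eu n => -x) (js.length + 1) c by
        convert h using 1; exact hl.symm
      refine ⟨half ((i :: js).map b), ?_, hh, ?_⟩
      · refine sup_mono ?_ (half_sup _)
        intro l' hl' x hx h0
        obtain ⟨φ, hφ⟩ := sign_fun b (List.nodup_cons.2 ⟨hnd.1, hnd.2⟩) hl'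
        have := fun_conv hφ x hx
        rw [Set.mem_singleton_iff.1 h0] at this
        simp at this
      · rw [hbdc]; exact cross_eq _ _
  obtain ⟨u0, hu0⟩ := exists_u (Eu n)
  have hborsuk := fun M => Theta_borsuk hhemi hodd hu0 M
  -- homotopy
  have hH := Hlem' (n := n) (A := Set.univ) (F := fun t x => O (x + t • w0)) (c := c) (by fun_prop) (by
    rw [hbdc]
    refine sup_mono ?_ (cross_sup _)
    intro l' hl'
    refine ⟨Set.subset_univ _, ?_⟩
    intro t ht x hx h
    have h1 := hO0 _ h
    obtain ⟨φ, hφ⟩ := sign_fun b hnd hl'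
    have h2 := fun_conv hφ x hx
    have h3 : φ (-w0) ≤ ∑ i, b.coord i (-w0) := by
      nth_rewrite 1 [← b.sum_repr (-w0)]
      rw [map_sum]
      refine Finset.sum_le_sum fun i _ => ?_
      rw [map_smul, smul_eq_mul]
      have h4 : φ (b i) ≤ 1 := by
        rcases signOf_mem' hl' (b i) (List.mem_map_of_mem (by simp [his])) with h | h
        · exact (hφ _ h).le
        · have := hφ _ h
          rw [map_neg] at this; linarith
      have := hpos i
      simp only [Module.Basis.coord_apply] at this ⊢
      nlinarith
    have h5 : φ (x + t • w0) = 0 := by rw [h1, map_zero]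
    rw [map_add, map_smul, h2, smul_eq_mul] at h5
    rw [map_neg] at h3
    have h6 : 0 < 1 + φ w0 := by linarith
    rcases ht.1.eq_or_lt with h7 | h7
    · rw [← h7] at h5; simp at h5
    · have := mul_pos h7 h6
      have := ht.2
      nlinarith)
  have hV := Vlem' (n := n) (D := fun x => O (x + (1:ℝ) • w0)) (c := cone 0 (rest (is.map b))) (by
    refine cone_sup ?_ (rest_sup b hnd)
    rintro l' ⟨i, _, hi⟩
    refine ⟨by fun_prop, ?_⟩
    intro x hx h
    have h1 := hO0 _ h
    have h2 : conv (0 :: l') ⊆ {x | b.coord i x ≤ 0} := by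
      refine conv_sub (convex_halfSpace_le (b.coord i).isLinear 0) ?_
      intro y hy
      rcases List.mem_cons.1 hy with rfl | hy
      · simp
      · exact hi y hy
    have h3 : b.coord i x ≤ 0 := h2 hx
    have h4 : x = -w0 := by rw [one_smul] at h1; exact eq_neg_of_add_eq_zero_left h1
    have := hpos i
    rw [h4] at h3
    linarith)
  filter_upwards [hH, hV] with M h1 h2 u
  have h3 := h1 u0 (fun x => u (x + w0))
  have h4 := hborsuk M
  have e0 : (fun x => O (x + (0:ℝ) • w0)) = O := by simp
  rw [e0, h4, hc, cross_rest, map_add, map_add, map_add, map_add, h2, add_zero, cone_bs] at h3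
  rw [hκ]
  have hb : BaryMap (fun x : Eu n => x + w0) := by
    have := baryMap_affine (AffineMap.id ℝ (Eu n) + AffineMap.const ℝ (Eu n) w0)
    exact this
  rw [← mapc_bs, ← mapc_SdM hb, mapc_mapc, h3]
  congr 3
  funext x
  simp [lab]

end
end CD

open scoped RealInnerProductSpace

namespace CD
noncomputable section
set_option linter.unusedSectionVars false

open Filter Topology

variable {n : ℕ}

/-- difference map -/
def Dth (θ : Eu n → Eu n) (z : Eu n × Eu n) : Eu n := θ z.2 - θ z.1

def Lz : (Eu n × Eu n) →ₗ[ℝ] Eu n := LinearMap.snd ℝ _ _ - LinearMap.fst ℝ _ _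

theorem Lz_apply (z : Eu n × Eu n) : Lz z = z.2 - z.1 := rfl

theorem isFace_map {V W : Type*} (f : V → W) {l : List W} {ρ : List V} (h : IsFace l (ρ.map f)) :
    ∃ l', IsFace l' ρ ∧ l = l'.map f := by
  obtain ⟨h1, h2⟩ := h
  rw [List.sublist_map_iff] at h1
  obtain ⟨l', h3, rfl⟩ := h1
  exact ⟨l', ⟨h3, by simpa using h2⟩, rfl⟩

theorem isFace_map' {V W : Type*} (f : V → W) {l ρ : List V} (h : IsFace l ρ) : IsFace (l.map f) (ρ.map f) :=
  ⟨h.1.map f, by simpa using h.2⟩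

theorem Dth_cont {θ : Eu n → Eu n} {U : Set (Eu n)} (hθ : ContinuousOn θ U) :
    ContinuousOn (Dth θ) (U ×ˢ U) :=
  (hθ.comp continuousOn_snd fun _ h => h.2).sub (hθ.comp continuousOn_fst fun _ h => h.1)

theorem Dth_ne {θ : Eu n → Eu n} {U : Set (Eu n)} (hi : Set.InjOn θ U) {z : Eu n × Eu n}
    (hz : z ∈ U ×ˢ U) (h : z.1 ≠ z.2) : Dth θ z ≠ 0 := by
  intro h0
  exact h (hi hz.1 hz.2 (sub_eq_zero.1 h0).symm)

theorem Aff0 {θ : Eu n → Eu n} {U : Set (Eu n)} (hθ : ContinuousOn θ U) (hi : Set.InjOn θ U)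
    (ρ : List (Eu n × Eu n)) (hU : conv ρ ⊆ U ×ˢ U) (h : ∀ z ∈ conv ρ, z.1 ≠ z.2) :
    ∀ᶠ M in atTop, ∀ u, Theta n (mapc (lab (Dth θ) u) (SdM M (bs ρ))) = 0 :=
  Vlem' (bs_mem ⟨(Dth_cont hθ).mono hU, fun z hz => Dth_ne hi (hU hz) (h z hz)⟩)

theorem Aff1 {θ : Eu n → Eu n} {U : Set (Eu n)} (hUo : IsOpen U) (hθ : ContinuousOn θ U) (hi : Set.InjOn θ U)
    (ρ : List (Eu n × Eu n)) (hlen : ρ.length = n + 1) (hU : conv ρ ⊆ U ×ˢ U)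
    (hf : ∀ l, IsFace l ρ → ∀ z ∈ conv l, z.1 ≠ z.2) (z0 : Eu n × Eu n) (hz0 : z0 ∈ conv ρ) (h0 : z0.1 = z0.2) :
    ∀ᶠ M in atTop, ∀ u, Theta n (mapc (lab (Dth θ) u) (SdM M (bs ρ))) = 1 := by
  obtain ⟨ε, hε, hεU⟩ := (conv_compact ρ).exists_cthickening_subset_open (hUo.prod hUo) hU
  set sc : Eu n → Eu n := fun w => (ε / (1 + ‖w‖)) • w with hsc
  have hsc_c : Continuous sc := by
    refine Continuous.smul (continuous_const.div (continuous_const.add continuous_norm) fun w => ?_) continuous_id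
    have := norm_nonneg w
    show (1:ℝ) + ‖w‖ ≠ 0
    positivity
  have hsc_n : ∀ w, ‖sc w‖ ≤ ε := by
    intro w
    rw [hsc]
    simp only [norm_smul, norm_div, Real.norm_of_nonneg hε.le]
    rw [Real.norm_of_nonneg (by positivity), div_mul_eq_mul_div, div_le_iff₀ (by positivity)]
    nlinarith [norm_nonneg w]
  have hsc_neg : ∀ w, sc (-w) = - sc w := fun w => by simp [hsc]
  set A : ℝ → (Eu n × Eu n) → (Eu n × Eu n) := fun s z =>
    (z0 + (1 - s) • (z - z0)) + s • (-(sc (Lz z)), sc (Lz z)) with hA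
  have hAc : Continuous (fun p : ℝ × (Eu n × Eu n) => A p.1 p.2) := by
    have : Continuous (fun z : Eu n × Eu n => sc (Lz z)) := by
      simp only [Lz_apply]; exact hsc_c.comp (by fun_prop)
    have h2 : Continuous (fun p : ℝ × (Eu n × Eu n) => sc (Lz p.2)) := this.comp continuous_snd
    simp only [hA]
    fun_prop
  have hAU : ∀ s ∈ Set.Icc (0:ℝ) 1, ∀ z ∈ conv ρ, A s z ∈ U ×ˢ U := by
    intro s hs z hz
    apply hεU
    have h1 : z0 + (1 - s) • (z - z0) ∈ conv ρ := by
      have := (conv_convex ρ) hz0 hz hs.1 (by linarith [hs.2] : 0 ≤ 1 - s) (by ring)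
      convert this using 1
      rw [smul_sub, sub_smul, sub_smul, one_smul]; module
    refine Metric.mem_cthickening_of_dist_le _ _ _ _ h1 ?_
    rw [dist_eq_norm]
    simp only [hA, add_sub_cancel_left]
    rw [norm_smul, Prod.norm_def]
    simp only [norm_neg, max_self]
    rw [Real.norm_of_nonneg hs.1]
    nlinarith [hs.1, hs.2, hsc_n (Lz z), norm_nonneg (sc (Lz z))]
  have hAL : ∀ s z, Lz (A s z) = ((1 - s) + 2 * s * (ε / (1 + ‖Lz z‖))) • Lz z := by
    intro s z
    have e0 : Lz z0 = 0 := by rw [Lz_apply, h0, sub_self]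
    simp only [hA, map_add, map_smul, map_sub, e0]
    have e2 : Lz ((-(sc (Lz z)), sc (Lz z)) : Eu n × Eu n) = sc (Lz z) - -(sc (Lz z)) := rfl
    rw [e2]
    simp only [hsc]
    module
  have hH := Hlem' (n := n) (A := conv ρ) (F := fun s z => Dth θ (A s z)) (c := bs ρ)
    ((Dth_cont hθ).comp hAc.continuousOn fun p hp => hAU p.1 hp.1 p.2 hp.2) (by
    refine sup_mono ?_ (bd_bs_sup ρ)
    intro l hl
    refine ⟨conv_face hl, ?_⟩
    intro t ht z hz
    refine Dth_ne hi (hAU t ht z (conv_face hl hz)) ?_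
    intro h
    have h1 : Lz (A t z) = 0 := by rw [Lz_apply, h, sub_self]
    rw [hAL, smul_eq_zero] at h1
    rcases h1 with h1 | h1
    · have : 0 < ε / (1 + ‖Lz z‖) := by positivity
      rcases ht.1.eq_or_lt with h2 | h2
      · rw [← h2] at h1; norm_num at h1
      · have := mul_pos h2 this
        have := ht.2
        nlinarith
    · rw [Lz_apply, sub_eq_zero] at h1
      exact hf l hl z hz h1.symm)
  set O : Eu n → Eu n := fun w => θ (z0.1 + sc w) - θ (z0.1 - sc w) with hO
  have hmem : ∀ w, z0.1 + sc w ∈ U ∧ z0.1 - sc w ∈ U := by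
    intro w
    have : (z0.1 - sc w, z0.1 + sc w) ∈ U ×ˢ U := by
      apply hεU
      refine Metric.mem_cthickening_of_dist_le _ _ _ _ hz0 ?_
      rw [Prod.dist_eq]
      refine max_le ?_ ?_
      · simpa [dist_eq_norm] using hsc_n w
      · simpa [dist_eq_norm, ← h0] using hsc_n w
    exact ⟨this.2, this.1⟩
  have hN := Norm (n := n) (O := O) ?_ ?_ ?_ (ρ.map Lz) (by simpa using hlen) ?_ ?_
  · filter_upwards [hH, hN] with M h1 h2 u
    have e0 : (fun z => Dth θ (A 0 z)) = Dth θ := by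
      funext z; simp only [hA, zero_smul, sub_zero, one_smul, add_sub_cancel]; rw [add_zero]
    have e1 : lab (fun z => Dth θ (A 1 z)) (0 : Eu n × Eu n → ZMod 2) = lab O (0 : Eu n → ZMod 2) ∘ Lz := by
      funext z
      simp only [lab, hA, Function.comp, hO, Dth]
      simp [← h0, sub_eq_add_neg]
    have h3 := h1 u 0
    rw [e0, e1, ← mapc_mapc, mapc_SdM (f := Lz) (baryMap_affine (Lz.toAffineMap)), mapc_bs] at h3
    rw [h3, h2]
  · rw [← continuousOn_univ]
    refine ContinuousOn.sub (hθ.comp (by fun_prop) fun w _ => (hmem w).1) (hθ.comp (by fun_prop) fun w _ => (hmem w).2)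
  · intro w; simp [hO, hsc_neg, sub_eq_add_neg, add_comm]
  · intro w hw
    have h1 := hi (hmem w).1 (hmem w).2 (sub_eq_zero.1 hw)
    have h2 : (2:ℝ) • sc w = 0 := by
      rw [two_smul]
      have := congrArg (fun x => x - z0.1 + sc w) h1
      simpa using this
    have h3 := (smul_eq_zero.1 h2).resolve_left (by norm_num)
    simp only [hsc, smul_eq_zero] at h3
    refine h3.resolve_left ?_
    positivity
  · have := conv_map (Lz (n := n)).toAffineMap ρ
    simp only [LinearMap.coe_toAffineMap] at this
    rw [this]
    exact ⟨z0, hz0, by rw [Lz_apply, h0, sub_self]⟩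
  · intro l hl
    obtain ⟨l', h1, rfl⟩ := isFace_map _ hl
    have := conv_map (Lz (n := n)).toAffineMap l'
    simp only [LinearMap.coe_toAffineMap] at this
    rw [this]
    rintro ⟨z, hz, h2⟩
    rw [Lz_apply, sub_eq_zero] at h2
    exact hf l' h1 z hz h2.symm

open Classical in
def Np (p : Eu n) : Ch (Eu n × Eu n) →ₗ[ZMod 2] ZMod 2 :=
  lin fun l => if ∃ z ∈ conv l, Lz z = p then 1 else 0

theorem conv_near {V : Type*} [NormedAddCommGroup V] [NormedSpace ℝ V] {l : List V} {d : ℝ} (hm : Mesh d l)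
    {x : V} (hx : x ∈ conv l) : ∃ y ∈ l, dist x y ≤ d := by
  have : l ≠ [] := by rintro rfl; simp [conv] at hx
  obtain ⟨y, hy⟩ := List.exists_mem_of_ne_nil l this
  exact ⟨y, hy, mesh_conv hm hx (mem_conv hy)⟩

theorem C1 {θ : Eu n → Eu n} {U : Set (Eu n)} (hUo : IsOpen U) (hθ : ContinuousOn θ U) (hi : Set.InjOn θ U)
    {Q Qb : Set (Eu n × Eu n)} (hQ : IsCompact Q) (hQU : Q ⊆ U ×ˢ U) (hQb : IsCompact Qb) (hQbU : Qb ⊆ U ×ˢ U)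
    (hne : ∀ z ∈ Qb, z.1 ≠ z.2) :
    ∃ η₀ > 0, ∀ η, 0 < η → η ≤ η₀ → ∀ γ : Ch (Eu n × Eu n),
      γ ∈ Sup {l | l.length = n + 1 ∧ Mesh η l ∧ ∀ z ∈ l, z ∈ Q} →
      bd γ ∈ Sup {l | ∀ z ∈ l, z ∈ Qb} → ∀ p : Eu n, ‖p‖ ≤ η →
      (∀ l ∈ γ.support, ∀ l', IsFace l' l → ∀ z ∈ conv l', Lz z ≠ p) →
      ∀ u, Theta n (mapc (lab (Dth θ) u) γ) = Np p γ := by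
  classical
  obtain ⟨r, hr, hrU⟩ := hQ.exists_cthickening_subset_open (hUo.prod hUo) hQU
  have hop : IsOpen ((U ×ˢ U) ∩ {z : Eu n × Eu n | z.1 ≠ z.2}) :=
    (hUo.prod hUo).inter (isOpen_ne_fun continuous_fst continuous_snd)
  obtain ⟨r', hr', hrU'⟩ := hQb.exists_cthickening_subset_open hop (fun z hz => ⟨hQbU hz, hne z hz⟩)
  have hcomp : IsCompact (Metric.cthickening r' Qb) := hQb.cthickening
  obtain ⟨η₁, hη₁, δ, hδ, g1, g2⟩ := unif hcomp (F := Dth θ) ((Dth_cont hθ).mono fun z hz => (hrU' hz).1)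
    (fun z hz => Dth_ne hi (hrU' hz).1 (hrU' hz).2)
  refine ⟨min (r / 2) (min (r' / 2) (δ / 2)), by positivity, ?_⟩
  intro η hη hle γ hγ hbγ p hp hgen u
  have hle1 : 2 * η ≤ r := by have := hle.trans (min_le_left _ _); linarith
  have hle2 : 2 * η ≤ r' := by have := (hle.trans (min_le_right _ _)).trans (min_le_left _ _); linarith
  have hle3 : 2 * η ≤ δ := by have := (hle.trans (min_le_right _ _)).trans (min_le_right _ _); linarith
  set sh : (Eu n × Eu n) →ᵃ[ℝ] (Eu n × Eu n) := AffineMap.id ℝ _ + AffineMap.const ℝ _ ((p, 0) : Eu n × Eu n) with hsh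
  have hsha : ∀ z, sh z = z + (p, 0) := fun z => rfl
  have hdsh : ∀ z, dist (sh z) z ≤ η := by
    intro z
    rw [hsha, dist_eq_norm, add_sub_cancel_left, Prod.norm_def]
    simpa using hp
  have hdsh2 : ∀ z w, dist (sh z) (sh w) = dist z w := by
    intro z w; rw [hsha, hsha, dist_add_right]
  have hLsh : ∀ z, Lz (sh z) = Lz z - p := by
    intro z; rw [hsha, Lz_apply, Lz_apply]; simp; abel
  have hmesh : bd γ ∈ Sup {l | Mesh η l ∧ ∀ z ∈ l, z ∈ Qb} := by
    have h1 : bd γ ∈ Sup {l | Mesh η l} := by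
      refine bd_sup ?_ hγ
      rintro l ⟨_, h2, _⟩ l' hl' x hx y hy
      exact h2 x (hl'.1.subset hx) y (hl'.1.subset hy)
    refine sup_mono ?_ (sup_inter h1 hbγ)
    exact fun l hl => ⟨hl.1, hl.2⟩
  have hin : ∀ z ∈ Qb, ∀ w, dist w z ≤ 2 * η → w ∈ Metric.cthickening r' Qb := fun z hz w hw =>
    Metric.mem_cthickening_of_dist_le w z _ _ hz (hw.trans hle2)
  -- Step A
  have stepA : Theta n (mapc (lab (Dth θ) u) γ) = Theta n (mapc (lab (Dth θ) u) (mapc sh γ)) := by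
    rw [mapc_mapc]
    refine H1 (η := η₁) (sup_mono ?_ hmesh)
    rintro l ⟨a1, a2⟩
    have b1 : ∀ x ∈ l, x ∈ Metric.cthickening r' Qb := fun x hx => hin x (a2 x hx) x (by simpa using hη.le)
    have b2 : ∀ x ∈ l, sh x ∈ Metric.cthickening r' Qb := fun x hx =>
      hin x (a2 x hx) _ ((hdsh x).trans (by linarith))
    refine ⟨fun x hx y hy => ⟨?_, ?_, ?_⟩, fun x hx => ⟨g1 _ (b1 x hx), g1 _ (b2 x hx)⟩⟩
    · exact g2 _ (b1 x hx) _ (b1 y hy) ((a1 x hx y hy).trans (by linarith))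
    · refine g2 _ (b1 x hx) _ (b2 y hy) ?_
      have := dist_triangle_right x (sh y) y
      have := a1 x hx y hy
      have := hdsh y
      linarith
    · refine g2 _ (b2 x hx) _ (b2 y hy) ?_
      rw [hdsh2]; exact (a1 x hx y hy).trans (by linarith)
  -- Step B
  have stepB : ∀ K, Theta n (mapc (lab (Dth θ) u) (mapc sh γ)) =
      Theta n (mapc (lab (Dth θ) u) (SdM K (mapc sh γ))) := by
    intro K
    have h1 := congrArg (fun c => Theta n (mapc (lab (Dth θ) u) c)) (TdM_eq K (mapc sh γ))
    simp only [map_add, mapc_bd, Theta_bd, zero_add] at h1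
    have h2 : Theta n (mapc (lab (Dth θ) u) (TdM K (bd (mapc sh γ)))) = 0 := by
      rw [← mapc_bd]
      refine Theta_van_sup (η := η₁) (mapc_sup (S := {l | Mesh η l ∧ ∀ x ∈ l, x ∈ Metric.cthickening r' Qb}) ?_ ?_)
      · rintro l ⟨a1, a2⟩
        constructor
        · intro x hx y hy
          obtain ⟨x', hx', rfl⟩ := List.mem_map.1 hx
          obtain ⟨y', hy', rfl⟩ := List.mem_map.1 hy
          exact g2 _ (a2 _ hx') _ (a2 _ hy') ((a1 _ hx' _ hy').trans (by linarith))
        · intro x hx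
          obtain ⟨x', hx', rfl⟩ := List.mem_map.1 hx
          exact g1 _ (a2 _ hx')
      · refine TdM_sup (S := {l | Mesh η l ∧ ∀ z ∈ l, ∃ w ∈ Qb, dist z w ≤ η}) K ?_ (mapc_sup ?_ hmesh)
        · rintro l ⟨a1, a2⟩ l' _ h
          refine ⟨fun x hx y hy => mesh_conv a1 (h x hx) (h y hy), fun x hx => ?_⟩
          obtain ⟨y, hy, hxy⟩ := conv_near a1 (h x hx)
          obtain ⟨w, hw, hyw⟩ := a2 y hy
          exact hin w hw x ((dist_triangle x y w).trans (by linarith))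
        · rintro l ⟨a1, a2⟩
          constructor
          · intro x hx y hy
            obtain ⟨x', hx', rfl⟩ := List.mem_map.1 hx
            obtain ⟨y', hy', rfl⟩ := List.mem_map.1 hy
            rw [hdsh2]; exact a1 _ hx' _ hy'
          · intro x hx
            obtain ⟨x', hx', rfl⟩ := List.mem_map.1 hx
            exact ⟨x', a2 _ hx', hdsh x'⟩
    rw [h2] at h1
    exact (CharTwo.add_eq_zero.1 h1.symm).symm
  -- Step C
  have stepC : ∀ᶠ K in atTop, Theta n (mapc (lab (Dth θ) u) (SdM K (mapc sh γ))) = Np p γ := by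
    refine sup_ind (p := fun γ => ∀ᶠ K in atTop, Theta n (mapc (lab (Dth θ) u) (SdM K (mapc sh γ))) = Np p γ)
      ?_ ?_ ?_ (sup_inter hγ (sup_supp γ))
    · simp
    · intro a b ha hb
      filter_upwards [ha, hb] with K h1 h2
      simp only [map_add, h1, h2]
    · rintro l ⟨⟨a1, a2, a3⟩, a4⟩
      have hcv : conv (l.map sh) = sh '' conv l := conv_map sh l
      have hU : conv (l.map sh) ⊆ U ×ˢ U := by
        rw [hcv]
        rintro _ ⟨z, hz, rfl⟩
        obtain ⟨y, hy, hzy⟩ := conv_near a2 hz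
        exact hrU (Metric.mem_cthickening_of_dist_le _ y _ _ (a3 y hy) (by
          have := dist_triangle (sh z) z y
          have := hdsh z
          linarith))
      rw [mapc_bs, Np, lin_bs]
      by_cases hz : ∃ z ∈ conv l, Lz z = p
      · rw [if_pos hz]
        obtain ⟨z, hz, hzp⟩ := hz
        have := Aff1 hUo hθ hi (l.map sh) (by simpa using a1) hU ?_ (sh z) (by rw [hcv]; exact ⟨z, hz, rfl⟩) ?_
        · filter_upwards [this] with K h using h u
        · intro l' hl'
          obtain ⟨l'', h1, rfl⟩ := isFace_map _ hl'
          rw [conv_map]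
          rintro _ ⟨z, hz, rfl⟩ h2
          have h3 := hLsh z
          rw [Lz_apply, ← h2, sub_self] at h3
          exact hgen l a4 l'' h1 z hz (sub_eq_zero.1 h3.symm)
        · have h3 := hLsh z
          rw [hzp, sub_self, Lz_apply] at h3
          exact (sub_eq_zero.1 h3).symm
      · rw [if_neg hz]
        have := Aff0 hθ hi (l.map sh) hU ?_
        · filter_upwards [this] with K h using h u
        · rw [hcv]
          rintro _ ⟨z, hz', rfl⟩ h2
          have h3 := hLsh z
          rw [Lz_apply, ← h2, sub_self] at h3
          exact hz ⟨z, hz', sub_eq_zero.1 h3.symm⟩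
  obtain ⟨K, hK⟩ := stepC.exists
  rw [stepA, stepB K, hK]

theorem conv_null (l : List (Eu n)) (hl : l.length = n) : MeasureTheory.volume (conv l) = 0 := by
  have hne : affineSpan ℝ {x | x ∈ l} ≠ ⊤ := by
    cases n with
    | zero =>
      rw [List.length_eq_zero_iff] at hl
      subst hl
      simp
    | succ k =>
      intro h
      have hr : {x | x ∈ l} = Set.range l.get := by
        ext x; simp [List.mem_iff_get]
      have h1 := finrank_vectorSpan_range_le ℝ l.get (n := k) (by simpa using hl)
      rw [← direction_affineSpan, ← hr, h, AffineSubspace.direction_top, finrank_top] at h1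
      simp at h1
  refine MeasureTheory.measure_mono_null ?_ (MeasureTheory.Measure.addHaar_affineSubspace _ _ hne)
  exact convexHull_subset_affineSpan _

theorem exists_generic (γ : Ch (Eu n × Eu n)) (hγ : γ ∈ Sup {l | l.length = n + 1}) {η : ℝ} (hη : 0 < η) :
    ∃ p : Eu n, ‖p‖ ≤ η ∧ ∀ l ∈ γ.support, ∀ l', IsFace l' l → ∀ z ∈ conv l', Lz z ≠ p := by
  classical
  rw [Sup, Finsupp.mem_supported] at hγ
  set B : Set (Eu n) := ⋃ l ∈ (γ.support : Set (List (Eu n × Eu n))), ⋃ l' ∈ {l' : List (Eu n × Eu n) | IsFace l' l}, conv (l'.map Lz)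
  have hB : MeasureTheory.volume B = 0 := by
    rw [MeasureTheory.measure_biUnion_null_iff γ.support.countable_toSet]
    intro l hl
    have hfin : {l' : List (Eu n × Eu n) | IsFace l' l}.Finite :=
      (List.finite_toSet l.sublists).subset fun l' h => List.mem_sublists.2 h.1
    rw [MeasureTheory.measure_biUnion_null_iff hfin.countable]
    intro l' hl'
    apply conv_null
    have := hl'.2
    have h2 : l.length = n + 1 := hγ hl
    rw [List.length_map]; omega
  have hpos : 0 < MeasureTheory.volume (Metric.ball (0 : Eu n) η) := Metric.measure_ball_pos _ _ hη
  have : ¬ (Metric.ball (0 : Eu n) η ⊆ B) := fun h => by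
    have := MeasureTheory.measure_mono (μ := MeasureTheory.volume) h
    rw [hB] at this
    exact absurd hpos (not_lt.2 this)
  obtain ⟨p, hp, hpB⟩ := Set.not_subset.1 this
  refine ⟨p, (mem_ball_zero_iff.1 hp).le, ?_⟩
  intro l hl l' hl' z hz hzp
  apply hpB
  refine Set.mem_iUnion₂.2 ⟨l, hl, Set.mem_iUnion₂.2 ⟨l', hl', ?_⟩⟩
  have := conv_map (Lz (n := n)).toAffineMap l'
  simp only [LinearMap.coe_toAffineMap] at this
  rw [this]
  exact ⟨z, hz, hzp⟩

theorem CI {V : Type*} [NormedAddCommGroup V] [NormedSpace ℝ V] {θ : Eu n → Eu n} {U : Set (Eu n)}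
    (hUo : IsOpen U) (hθ : ContinuousOn θ U) (hi : Set.InjOn θ U) (τ : List V) (hlen : τ.length = n + 1)
    {α β : V → Eu n} (hα : ContinuousOn α (conv τ)) (hβ : ContinuousOn β (conv τ))
    (hαU : Set.MapsTo α (conv τ) U) (hβU : Set.MapsTo β (conv τ) U)
    (hne : ∀ l, IsFace l τ → ∀ x ∈ conv l, α x ≠ β x) :
    ∀ᶠ M in atTop, ∀ u, Theta n (mapc (lab (fun x => β x - α x) u) (SdM M (bs τ))) =
      Theta n (mapc (lab (fun x => θ (β x) - θ (α x)) u) (SdM M (bs τ))) := by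
  classical
  set ab : V → Eu n × Eu n := fun x => (α x, β x) with hab
  have habc : ContinuousOn ab (conv τ) := hα.prodMk hβ
  set Kb : Set V := ⋃ l ∈ (bd (bs τ)).support, conv l with hKb
  have hKbc : IsCompact Kb := (bd (bs τ)).support.isCompact_biUnion fun l _ => conv_compact l
  have hsup : ∀ l ∈ (bd (bs τ)).support, IsFace l τ := by
    have := bd_bs_sup τ
    rw [Sup, Finsupp.mem_supported] at this
    exact fun l hl => this hl
  have hKbτ : Kb ⊆ conv τ := Set.iUnion₂_subset fun l hl => conv_face (hsup l hl)
  have hQ := (conv_compact τ).image_of_continuousOn habc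
  have hQb := hKbc.image_of_continuousOn (habc.mono hKbτ)
  have hQU : ab '' conv τ ⊆ U ×ˢ U := by
    rintro _ ⟨x, hx, rfl⟩; exact ⟨hαU hx, hβU hx⟩
  have hQbne : ∀ z ∈ ab '' Kb, z.1 ≠ z.2 := by
    rintro _ ⟨x, hx, rfl⟩
    obtain ⟨l, hl, hx⟩ := Set.mem_iUnion₂.1 hx
    exact hne l (hsup l hl) x hx
  obtain ⟨η1, hη1, c1⟩ := C1 hUo hθ hi hQ hQU hQb ((Set.image_mono hKbτ).trans hQU) hQbne
  obtain ⟨η2, hη2, c2⟩ := C1 (θ := id) hUo continuousOn_id (Set.injOn_id U) hQ hQU hQb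
    ((Set.image_mono hKbτ).trans hQU) hQbne
  set η := min η1 η2
  have hη : 0 < η := lt_min hη1 hη2
  have huc := (conv_compact τ).uniformContinuousOn_of_continuous habc
  rw [Metric.uniformContinuousOn_iff] at huc
  obtain ⟨δ, hδ, huc⟩ := huc η hη
  have hb : bd (bs τ) ∈ Sup {l | conv l ⊆ Kb} := by
    refine sup_mono ?_ (sup_supp _)
    intro l hl
    exact Set.subset_biUnion_of_mem (u := fun l => conv l) hl
  have indep : ∀ θ : Eu n → Eu n, ContinuousOn θ U → Set.InjOn θ U → ∀ᶠ M in atTop, ∀ u u',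
      Theta n (mapc (lab (fun x => θ (β x) - θ (α x)) u) (SdM M (bs τ))) =
      Theta n (mapc (lab (fun x => θ (β x) - θ (α x)) u') (SdM M (bs τ))) := by
    intro θ hθ hi
    refine Hlem (n := n) hKbc (F := fun _ x => θ (β x) - θ (α x)) ?_ ?_ hb
    · have h1 : ContinuousOn (fun x => θ (β x) - θ (α x)) Kb :=
        ((hθ.comp hβ hβU).sub (hθ.comp hα hαU)).mono hKbτ
      exact h1.comp continuousOn_snd fun p hp => hp.2
    · intro _ _ x hx h
      have := hQbne (ab x) ⟨x, hx, rfl⟩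
      exact this (hi (hβU (hKbτ hx)) (hαU (hKbτ hx)) (sub_eq_zero.1 h)).symm
  filter_upwards [indep θ hθ hi, indep id continuousOn_id (Set.injOn_id U), mesh_ev (bs τ) (half_pos hδ)]
    with M h1 h2 h3 u
  rw [h1 u 0]
  have h2' := h2 u 0
  simp only [id] at h2'
  rw [h2']
  have hs : SdM M (bs τ) ∈ Sup ({l | Mesh (δ / 2) l} ∩ ({l | conv l ⊆ conv τ} ∩ {l | l.length = n + 1})) :=
    sup_inter h3 (sup_inter (SdM_sup (sdClosed_conv _) M (bs_mem (S := {l | conv l ⊆ conv τ}) fun x hx => hx))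
      (SdM_sup (sdClosed_len _) M (bs_mem hlen)))
  set γ := mapc ab (SdM M (bs τ)) with hγdef
  have hγ : γ ∈ Sup {l | l.length = n + 1 ∧ Mesh η l ∧ ∀ z ∈ l, z ∈ ab '' conv τ} := by
    refine mapc_sup ?_ hs
    rintro l ⟨a1, a2, a3⟩
    refine ⟨by simpa using a3, ?_, ?_⟩
    · intro x hx y hy
      obtain ⟨x', hx', rfl⟩ := List.mem_map.1 hx
      obtain ⟨y', hy', rfl⟩ := List.mem_map.1 hy
      exact (huc x' (a2 (mem_conv hx')) y' (a2 (mem_conv hy')) ((a1 _ hx' _ hy').trans_lt (by linarith))).le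
    · intro x hx
      obtain ⟨x', hx', rfl⟩ := List.mem_map.1 hx
      exact ⟨x', a2 (mem_conv hx'), rfl⟩
  have hbγ : bd γ ∈ Sup {l | ∀ z ∈ l, z ∈ ab '' Kb} := by
    rw [hγdef, ← mapc_bd, bd_SdM]
    refine mapc_sup ?_ (SdM_sup (sdClosed_conv _) M hb)
    intro l a x hx
    obtain ⟨x', hx', rfl⟩ := List.mem_map.1 hx
    exact ⟨x', a (mem_conv hx'), rfl⟩
  obtain ⟨p, hp, hgen⟩ := exists_generic γ (sup_mono (fun l hl => hl.1) hγ) hη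
  have e1 := c1 η hη (min_le_left _ _) γ hγ hbγ p hp hgen 0
  have e2 := c2 η hη (min_le_right _ _) γ hγ hbγ p hp hgen 0
  rw [hγdef, mapc_mapc] at e1 e2
  exact e2.trans e1.symm

end
end CD

open scoped RealInnerProductSpace

namespace CD
noncomputable section
set_option linter.unusedSectionVars false

open Filter Topology

variable {n : ℕ}
variable {V : Type*} [NormedAddCommGroup V] [NormedSpace ℝ V] [FiniteDimensional ℝ V]
variable {Y : Type*} [TopologicalSpace Y] [T2Space Y] [ChartedSpace (Eu n) Y]

/-- no antipodal coincidence on the simplex -/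
def Free (G : C(V, Y)) (l : List V) : Prop := ∀ x ∈ conv l, G x ≠ G (-x)

/-- both the simplex and its antipode are mapped into the chart domain at `y` -/
def In (n : ℕ) {Y : Type*} [TopologicalSpace Y] [ChartedSpace (Eu n) Y] (y : Y) (G : C(V, Y)) (l : List V) : Prop :=
  ∀ x ∈ conv l, G x ∈ (chartAt (Eu n) y).source ∧ G (-x) ∈ (chartAt (Eu n) y).source

def Pos (l : List V) : Prop := ∃ φ : V →ₗ[ℝ] ℝ, ∀ x ∈ conv l, 0 < φ x

def negC : C(V, V) := ⟨fun x => -x, continuous_neg⟩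

theorem isOpen_free (l : List V) : IsOpen {G : C(V, Y) | Free G l} := by
  have h1 : IsOpen {p : Y × Y | p.1 ≠ p.2} := isClosed_diagonal.isOpen_compl
  have h2 := ContinuousMap.isOpen_setOfPred_mapsTo (conv_compact l) h1
  have h3 : Continuous (fun G : C(V, Y) => G.prodMk (G.comp negC)) := by
    refine ContinuousMap.continuous_of_continuous_uncurry _ ?_
    show Continuous fun p : C(V, Y) × V => (p.1 p.2, p.1 (-p.2))
    fun_prop
  exact h2.preimage h3

theorem isOpen_in (y : Y) (l : List V) : IsOpen {G : C(V, Y) | In n y G l} := by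
  have h1 : IsOpen ((chartAt (Eu n) y).source ×ˢ (chartAt (Eu n) y).source) :=
    (chartAt (Eu n) y).open_source.prod (chartAt (Eu n) y).open_source
  have h2 := ContinuousMap.isOpen_setOfPred_mapsTo (conv_compact l) h1
  have h3 : Continuous (fun G : C(V, Y) => G.prodMk (G.comp negC)) := by
    refine ContinuousMap.continuous_of_continuous_uncurry _ ?_
    show Continuous fun p : C(V, Y) × V => (p.1 p.2, p.1 (-p.2))
    fun_prop
  exact h2.preimage h3

theorem exists_family (ψ : OpenPartialHomeomorph Y (Eu n)) (G : C(V, Y)) {K L : Set V} (hK : IsCompact K)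
    (hL : IsClosed L) (hKL : Disjoint K L) (hG : ∀ x ∈ K, G x ∈ ψ.source) :
    ∃ (r : ℝ) (H : C(V × Eu n, Y)), 0 < r ∧ (∀ x, H (x, 0) = G x) ∧ (∀ x ∈ L, ∀ w, H (x, w) = G x) ∧
      (∀ x ∈ K, ∀ w, ‖w‖ ≤ r → H (x, w) ∈ ψ.source ∧ ψ (H (x, w)) = ψ (G x) + w) := by
  classical
  have hψG : ContinuousOn (fun x => ψ (G x)) K := ψ.continuousOn.comp G.continuous.continuousOn hG
  obtain ⟨r2, hr2, hr2T⟩ := (hK.image_of_continuousOn hψG).exists_cthickening_subset_open ψ.open_target (by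
    rintro _ ⟨x, hx, rfl⟩; exact ψ.map_source (hG x hx))
  set r := r2 / 2 with hr
  have hr0 : 0 < r := by positivity
  set Th := Metric.thickening r ((fun x => ψ (G x)) '' K)
  set A : Set V := G ⁻¹' (ψ.source ∩ ψ ⁻¹' Th) with hA
  have hAo : IsOpen A := (ψ.isOpen_inter_preimage Metric.isOpen_thickening).preimage G.continuous
  have hKA : K ⊆ A := fun x hx => ⟨hG x hx, Metric.self_subset_thickening hr0 _ ⟨x, hx, rfl⟩⟩
  have hT : ∀ x ∈ A, ∀ w : Eu n, ‖w‖ ≤ r → ψ (G x) + w ∈ ψ.target := by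
    intro x hx w hw
    apply hr2T
    obtain ⟨z, hz, hz2⟩ := Metric.mem_thickening_iff.1 hx.2
    refine Metric.mem_cthickening_of_dist_le _ z _ _ hz ?_
    have h1 : dist (ψ (G x) + w) (ψ (G x)) = ‖w‖ := by rw [dist_eq_norm, add_sub_cancel_left]
    have := dist_triangle (ψ (G x) + w) (ψ (G x)) z
    linarith
  obtain ⟨l0, hl0, hl1, hl2⟩ := exists_continuous_zero_one_of_isClosed (hAo.isClosed_compl.union hL) hK.isClosed (by
    rw [Set.disjoint_union_left]
    exact ⟨Set.disjoint_compl_left_iff_subset.2 hKA, hKL.symm⟩)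
  set lam : V → ℝ := fun x => max 0 (2 * l0 x - 1) with hlam
  have hlamc : Continuous lam := by
    have := l0.continuous
    fun_prop
  have hlam1 : ∀ x, |lam x| ≤ 1 := by
    intro x
    have := (hl2 x).2
    rw [abs_of_nonneg (le_max_left _ _)]
    exact max_le zero_le_one (by linarith)
  set clip : Eu n → Eu n := fun w => (r / max r ‖w‖) • w with hclip
  have hclipc : Continuous clip := by
    refine Continuous.smul (continuous_const.div (continuous_const.max continuous_norm) fun w => ?_) continuous_id
    exact (lt_max_of_lt_left hr0).ne'
  have hclipn : ∀ w, ‖clip w‖ ≤ r := by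
    intro w
    have h0 : 0 < max r ‖w‖ := lt_max_of_lt_left hr0
    rw [hclip]
    simp only [norm_smul, norm_div, Real.norm_of_nonneg hr0.le]
    rw [Real.norm_of_nonneg h0.le, div_mul_eq_mul_div, div_le_iff₀ h0]
    exact mul_le_mul_of_nonneg_left (le_max_right _ _) hr0.le
  have hclipw : ∀ w, ‖w‖ ≤ r → clip w = w := by
    intro w hw
    simp only [hclip]
    rw [max_eq_left hw, div_self hr0.ne', one_smul]
  have hn2 : ∀ x w, ‖lam x • clip w‖ ≤ r := by
    intro x w
    rw [norm_smul, Real.norm_eq_abs]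
    have := hlam1 x
    have := hclipn w
    nlinarith [abs_nonneg (lam x), norm_nonneg (clip w)]
  set H : V × Eu n → Y := fun p => if p.1 ∈ A then ψ.symm (ψ (G p.1) + lam p.1 • clip p.2) else G p.1 with hH
  have hz : ∀ x w, lam x = 0 → H (x, w) = G x := by
    intro x w h0
    simp only [hH, h0, zero_smul, add_zero]
    split_ifs with h
    · exact ψ.left_inv h.1
    · rfl
  have hHc : Continuous H := by
    rw [continuous_iff_continuousAt]
    rintro ⟨x, w⟩
    by_cases hx : x ∈ A
    · have h1 : ContinuousAt (fun p : V × Eu n => ψ (G p.1) + lam p.1 • clip p.2) (x, w) := by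
        refine ContinuousAt.add ?_ ?_
        · have : ContinuousAt ψ (G x) := ψ.continuousAt hx.1
          exact ContinuousAt.comp (f := fun p : V × Eu n => G p.1) this (G.continuous.comp continuous_fst).continuousAt
        · exact ((hlamc.comp continuous_fst).smul (hclipc.comp continuous_snd)).continuousAt
      have h2 : ContinuousAt (fun p : V × Eu n => ψ.symm (ψ (G p.1) + lam p.1 • clip p.2)) (x, w) :=
        ContinuousAt.comp (f := fun p : V × Eu n => ψ (G p.1) + lam p.1 • clip p.2)
          (ψ.continuousAt_symm (hT x hx _ (hn2 x w))) h1
      refine h2.congr ?_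
      filter_upwards [(hAo.preimage continuous_fst).mem_nhds (show (x, w) ∈ Prod.fst ⁻¹' A from hx)] with p hp
      simp only [hH]
      rw [if_pos (show p.1 ∈ A from hp)]
    · have h1 : ContinuousAt (fun p : V × Eu n => G p.1) (x, w) := (G.continuous.comp continuous_fst).continuousAt
      refine h1.congr ?_
      have h2 : l0 x < 1 / 2 := by
        have := hl0 (Or.inl hx : x ∈ Aᶜ ∪ L)
        rw [this]; norm_num
      have h3 : IsOpen {p : V × Eu n | l0 p.1 < 1 / 2} :=
        isOpen_lt (l0.continuous.comp continuous_fst) continuous_const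
      filter_upwards [h3.mem_nhds h2] with p hp
      refine (hz p.1 p.2 ?_).symm
      simp only [hlam]
      exact max_eq_left (by have : l0 p.1 < 1 / 2 := hp
                            linarith)
  refine ⟨r, ⟨H, hHc⟩, hr0, ?_, ?_, ?_⟩
  · intro x
    show H (x, 0) = G x
    have h0 : clip 0 = 0 := by simp [hclip]
    simp only [hH, h0, smul_zero, add_zero]
    split_ifs with h
    · exact ψ.left_inv h.1
    · rfl
  · intro x hx w
    refine hz x w ?_
    have := hl0 (Or.inr hx : x ∈ Aᶜ ∪ L)
    simp only [hlam, this]; norm_num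
  · intro x hx w hw
    have h1 : lam x = 1 := by
      have := hl1 hx
      simp only [hlam, this]; norm_num
    show H (x, w) ∈ ψ.source ∧ ψ (H (x, w)) = _
    simp only [hH]
    rw [if_pos (hKA hx), h1, one_smul, hclipw w hw]
    have := hT x (hKA hx) w hw
    exact ⟨ψ.map_target this, ψ.right_inv this⟩

theorem dense_avoid (d : V → Eu n) (hd : ContDiff ℝ 1 d) (l : List V) (hl : l.length ≤ n) :
    Dense ((fun x => - d x) '' conv l)ᶜ := by
  rcases l with _ | ⟨p0, l⟩
  · simp [conv]
  · set W := vectorSpan ℝ {x | x ∈ p0 :: l} with hW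
    have h1 : Module.finrank ℝ W < n := by
      have hr : {x | x ∈ p0 :: l} = Set.range (p0 :: l).get := by
        ext x; simp only [List.mem_iff_get, Set.mem_range, Set.mem_setOf_eq]
      have := finrank_vectorSpan_range_le ℝ (p0 :: l).get (n := l.length) (by simp)
      rw [← hr] at this
      simp at hl
      exact this.trans_lt hl
    have h2 : ContDiff ℝ 1 (fun w : W => - d (p0 + w)) :=
      (hd.comp (contDiff_const.add W.subtypeL.contDiff)).neg
    refine (h2.dense_compl_range_of_finrank_lt_finrank (by simpa [Eu] using h1)).mono ?_
    rw [Set.compl_subset_compl]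
    rintro _ ⟨x, hx, rfl⟩
    have h3 : x ∈ affineSpan ℝ {x | x ∈ p0 :: l} := convexHull_subset_affineSpan _ hx
    have h4 : x -ᵥ p0 ∈ (affineSpan ℝ {x | x ∈ p0 :: l}).direction :=
      AffineSubspace.vsub_mem_direction h3 (subset_affineSpan ℝ _ (by simp))
    rw [direction_affineSpan] at h4
    exact ⟨⟨x - p0, h4⟩, by simp⟩

theorem perturb1 {O : Set C(V, Y)} (hO : IsOpen O) {G : C(V, Y)} (hG : G ∈ O) (l : List V) (hl : l.length ≤ n)
    (hp : Pos l) (hy : Free G l ∨ ∃ y, In n y G l) : ∃ G' ∈ O, Free G' l := by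
  rcases hy with h | ⟨y, hy⟩
  · exact ⟨G, hG, h⟩
  set ψ := chartAt (Eu n) y
  set K := conv l with hK
  have hKc : IsCompact K := conv_compact l
  have hLc : IsClosed (-K) := hKc.neg.isClosed
  have hdis : Disjoint K (-K) := by
    obtain ⟨φ, hφ⟩ := hp
    rw [Set.disjoint_left]
    intro x hx hx'
    have h1 := hφ x hx
    have h2 := hφ (-x) hx'
    rw [map_neg] at h2
    linarith
  obtain ⟨r, H, hr, H0, HL, HK⟩ := exists_family ψ G hKc hLc hdis (fun x hx => (hy x hx).1)
  set Φ : C(V, Eu n) → C(V, Y) := fun e => H.comp ((ContinuousMap.id V).prodMk e) with hΦ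
  have hΦc : Continuous Φ := by
    refine ContinuousMap.continuous_of_continuous_uncurry _ ?_
    show Continuous fun p : C(V, Eu n) × V => H (p.2, p.1 p.2)
    fun_prop
  set N : Set C(V, Eu n) := Φ ⁻¹' O ∩ {e | Set.MapsTo e K (Metric.ball 0 r)} with hN
  have hNo : IsOpen N := (hO.preimage hΦc).inter
    (ContinuousMap.isOpen_setOfPred_mapsTo hKc Metric.isOpen_ball)
  have hN0 : (0 : C(V, Eu n)) ∈ N := by
    refine ⟨?_, ?_⟩
    · have : Φ 0 = G := by ext x; exact H0 x
      show Φ 0 ∈ O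
      rwa [this]
    · intro x _; simpa using hr
  have hdc : ContinuousOn (fun x => ψ (G x) - ψ (G (-x))) K := by
    refine ContinuousOn.sub ?_ ?_
    · exact ψ.continuousOn.comp G.continuous.continuousOn fun x hx => (hy x hx).1
    · exact ψ.continuousOn.comp (G.continuous.comp continuous_neg).continuousOn fun x hx => (hy x hx).2
  obtain ⟨d', hd'⟩ := ContinuousMap.exists_restrict_eq hKc.isClosed
    (⟨K.domRestrict fun x => ψ (G x) - ψ (G (-x)), continuousOn_iff_continuous_domRestrict.1 hdc⟩ : C(K, Eu n))
  have hd'' : ∀ x ∈ K, d' x = ψ (G x) - ψ (G (-x)) := fun x hx => by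
    have := congrArg (fun g : C(K, Eu n) => g ⟨x, hx⟩) hd'
    exact this
  obtain ⟨dt, hdt, hdts⟩ := (ContinuousMap.dense_setOfPred_contDiff (E := V) (F := Eu n)).exists_mem_open
    (hNo.preimage (continuous_id.sub continuous_const : Continuous fun e : C(V, Eu n) => e - d'))
    ⟨d', by show d' - d' ∈ N; rwa [sub_self]⟩
  set cst : Eu n → C(V, Eu n) := fun v => dt + ContinuousMap.const V v - d' with hcst
  have hcstc : Continuous cst := by
    refine ContinuousMap.continuous_of_continuous_uncurry _ ?_
    show Continuous fun p : Eu n × V => dt p.2 + p.1 - d' p.2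
    fun_prop
  have hdt1 : ContDiff ℝ 1 dt := by
    have h : ContDiff ℝ (((⊤ : ℕ∞) : WithTop ℕ∞)) dt := hdt
    exact h.of_le (by exact_mod_cast le_top)
  obtain ⟨v, hv1, hv2⟩ := (dense_avoid dt hdt1 l hl).exists_mem_open
    (hNo.preimage hcstc) ⟨0, by
      show cst 0 ∈ N
      have : cst 0 = dt - d' := by ext x; simp [hcst]
      rw [this]; exact hdts⟩
  refine ⟨Φ (cst v), hv2.1, ?_⟩
  intro x hx heq
  have h1 : H (x, cst v x) = H (-x, cst v (-x)) := heq
  rw [HL (-x) (by simpa using hx)] at h1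
  have h2 := (HK x hx (cst v x) (mem_ball_zero_iff.1 (hv2.2 hx)).le).2
  rw [h1] at h2
  have h3 : cst v x = dt x + v - d' x := rfl
  rw [h3, hd'' x hx] at h2
  apply hv1
  refine ⟨x, hx, ?_⟩
  have h4 : dt x + v = 0 := by
    have := congrArg (fun z => z - ψ (G (-x))) h2
    simp only [sub_self] at this
    rw [this]; abel
  exact neg_eq_of_add_eq_zero_right h4

theorem perturb {O : Set C(V, Y)} (hO : IsOpen O) (hne : O.Nonempty) (T : List (List V))
    (hT : ∀ l ∈ T, l.length ≤ n ∧ Pos l ∧ ∀ G ∈ O, (Free G l ∨ ∃ y, In n y G l)) :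
    ∃ G ∈ O, ∀ l ∈ T, Free G l := by
  induction T generalizing O with
  | nil => obtain ⟨G, hG⟩ := hne; exact ⟨G, hG, by simp⟩
  | cons l T ih =>
    obtain ⟨G, hG⟩ := hne
    obtain ⟨h1, h2, h3⟩ := hT l (by simp)
    obtain ⟨G', hG', hf⟩ := perturb1 hO hG l h1 h2 (h3 G hG)
    obtain ⟨G2, hG2, h4⟩ := ih (O := O ∩ {G | Free G l}) (hO.inter (isOpen_free l)) ⟨G', hG', hf⟩
      (fun l' hl' => ⟨(hT l' (by simp [hl'])).1, (hT l' (by simp [hl'])).2.1, fun G hG => (hT l' (by simp [hl'])).2.2 G hG.1⟩)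
    refine ⟨G2, hG2.1, fun l' hl' => ?_⟩
    rcases List.mem_cons.1 hl' with rfl | h
    · exact hG2.2
    · exact h4 l' h

end
end CD

open scoped RealInnerProductSpace

namespace CD
noncomputable section
set_option linter.unusedSectionVars false

open Filter Topology

variable {n : ℕ}
variable {V : Type*} [NormedAddCommGroup V] [NormedSpace ℝ V] [FiniteDimensional ℝ V]
variable {Y : Type*} [TopologicalSpace Y] [T2Space Y] [ChartedSpace (Eu n) Y]

/-- the antipodal difference in the chart at `y` -/
def Dy (n : ℕ) {Y : Type*} [TopologicalSpace Y] [ChartedSpace (Eu n) Y] (y : Y) (G : C(V, Y)) (x : V) : Eu n :=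
  chartAt (Eu n) y (G (-x)) - chartAt (Eu n) y (G x)

theorem Dy_neg (y : Y) (G : C(V, Y)) (x : V) : Dy n y G (-x) = - Dy n y G x := by
  simp [Dy]

open Classical in
/-- local index functional -/
def io (n : ℕ) {Y : Type*} [TopologicalSpace Y] [ChartedSpace (Eu n) Y] (G : C(V, Y)) (u : V → ZMod 2) (M : ℕ) :
    Ch V →ₗ[ZMod 2] ZMod 2 :=
  lin fun τ => if h : ∃ y, In n y G τ then Theta n (mapc (lab (Dy n h.choose G) u) (SdM M (bs τ))) else 0

theorem sd_congr {W : Type*} {f g : V → W} (τ : List V) (h : ∀ x ∈ conv τ, f x = g x) (M : ℕ) :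
    mapc f (SdM M (bs τ)) = mapc g (SdM M (bs τ)) := by
  refine mapc_congr (S := {l | conv l ⊆ conv τ}) (fun l hl x hx => h x (hl (mem_conv hx))) ?_
  exact SdM_sup (sdClosed_conv _) M (bs_mem (S := {l | conv l ⊆ conv τ}) fun x hx => hx)

theorem F1 (G : C(V, Y)) (u : V → ZMod 2) (τ : List V) (hlen : τ.length = n + 1) (y : Y) (hy : In n y G τ)
    (hf : ∀ l, IsFace l τ → Free G l) :
    ∀ᶠ M in atTop, io n G u M (bs τ) = Theta n (mapc (lab (Dy n y G) u) (SdM M (bs τ))) := by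
  have h : ∃ y, In n y G τ := ⟨y, hy⟩
  have hy' := h.choose_spec
  set y' := h.choose with hyd
  set ψ := chartAt (Eu n) y
  set ψ' := chartAt (Eu n) y'
  have hc := CI (V := V) (n := n) (θ := fun w => ψ' (ψ.symm w)) (U := (ψ.symm.trans ψ').source)
    (ψ.symm.trans ψ').open_source (ψ.symm.trans ψ').continuousOn (ψ.symm.trans ψ').injOn τ hlen
    (α := fun x => ψ (G x)) (β := fun x => ψ (G (-x)))
    (ψ.continuousOn.comp G.continuous.continuousOn fun x hx => (hy x hx).1)
    (ψ.continuousOn.comp (G.continuous.comp continuous_neg).continuousOn fun x hx => (hy x hx).2)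
    ?_ ?_ ?_
  · filter_upwards [hc] with M hM
    rw [io, lin_bs, dif_pos h]
    have h2 := hM u
    refine Eq.trans ?_ h2.symm
    congr 1
    apply sd_congr
    intro x hx
    simp only [lab, Dy]
    have e1 := ψ.left_inv (hy x hx).1
    have e2 := ψ.left_inv (hy x hx).2
    rw [e1, e2]
  · intro x hx
    rw [OpenPartialHomeomorph.trans_source]
    refine ⟨ψ.map_source (hy x hx).1, ?_⟩
    show ψ.symm (ψ (G x)) ∈ ψ'.source
    rw [ψ.left_inv (hy x hx).1]
    exact (hy' x hx).1
  · intro x hx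
    rw [OpenPartialHomeomorph.trans_source]
    refine ⟨ψ.map_source (hy x hx).2, ?_⟩
    show ψ.symm (ψ (G (-x))) ∈ ψ'.source
    rw [ψ.left_inv (hy x hx).2]
    exact (hy' x hx).2
  · intro l hl x hx heq
    have := hy x (conv_face hl hx)
    exact hf l hl x hx (ψ.injOn this.1 this.2 heq)

theorem F1s (G : C(V, Y)) (u : V → ZMod 2) (y : Y) {c : Ch V}
    (hc : c ∈ Sup {τ | τ.length = n + 1 ∧ In n y G τ ∧ ∀ l, IsFace l τ → Free G l}) :
    ∀ᶠ M in atTop, io n G u M c = Theta n (mapc (lab (Dy n y G) u) (SdM M c)) := by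
  refine sup_ind (p := fun c => ∀ᶠ M in atTop, io n G u M c = Theta n (mapc (lab (Dy n y G) u) (SdM M c)))
    ?_ ?_ ?_ hc
  · simp
  · intro a b ha hb
    filter_upwards [ha, hb] with M h1 h2
    simp only [map_add, h1, h2]
  · rintro τ ⟨h1, h2, h3⟩
    exact F1 G u τ h1 y h2 h3

theorem F2 (G : C(V, Y)) (u : V → ZMod 2) {c : Ch V} (hc : c ∈ Sup {τ | Free G τ}) :
    ∀ᶠ M in atTop, io n G u M c = 0 := by
  refine sup_ind (p := fun c => ∀ᶠ M in atTop, io n G u M c = 0) ?_ ?_ ?_ hc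
  · simp
  · intro a b ha hb
    filter_upwards [ha, hb] with M h1 h2
    simp only [map_add, h1, h2, add_zero]
  · intro τ hτ
    by_cases h : ∃ y, In n y G τ
    · have hy := h.choose_spec
      have := Vlem' (n := n) (D := Dy n h.choose G) (c := bs τ) (bs_mem ⟨?_, ?_⟩)
      · filter_upwards [this] with M hM
        rw [io, lin_bs, dif_pos h]
        exact hM u
      · exact ((chartAt (Eu n) h.choose).continuousOn.comp (G.continuous.comp continuous_neg).continuousOn
            fun x hx => (hy x hx).2).sub
          ((chartAt (Eu n) h.choose).continuousOn.comp G.continuous.continuousOn fun x hx => (hy x hx).1)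
      · intro x hx h0
        exact hτ x hx ((chartAt (Eu n) h.choose).injOn (hy x hx).1 (hy x hx).2 (sub_eq_zero.1 h0).symm)
    · filter_upwards with M
      rw [io, lin_bs, dif_neg h]

def Good (n : ℕ) {Y : Type*} [TopologicalSpace Y] [ChartedSpace (Eu n) Y] (G : C(V, Y)) (l : List V) : Prop :=
  Free G l ∨ ∃ y, In n y G l

theorem Good_sub {G : C(V, Y)} {l l' : List V} (h : Good n G l) (hl : conv l' ⊆ conv l) : Good n G l' :=
  h.imp (fun h x hx => h x (hl hx)) fun ⟨y, h⟩ => ⟨y, fun x hx => h x (hl hx)⟩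

theorem F3 (G : C(V, Y)) (u : V → ZMod 2) {c : Ch V}
    (hc : c ∈ Sup {ρ | ρ.length = n + 2 ∧ Good n G ρ ∧ ∀ l : List V, l.Sublist ρ → l.length = n → Free G l}) :
    ∀ᶠ M in atTop, io n G u M (bd c) = 0 := by
  refine sup_ind (p := fun c => ∀ᶠ M in atTop, io n G u M (bd c) = 0) ?_ ?_ ?_ hc
  · simp
  · intro a b ha hb
    filter_upwards [ha, hb] with M h1 h2
    simp only [map_add, h1, h2, add_zero]
  · rintro ρ ⟨h1, h2 | ⟨y, h2⟩, h3⟩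
    · apply F2
      refine sup_mono ?_ (bd_bs_sup ρ)
      exact fun l hl x hx => h2 x (conv_face hl hx)
    · have := F1s G u y (c := bd (bs ρ)) (by
        refine sup_mono ?_ (bd_bs_sup ρ)
        intro τ hτ
        have hlen : τ.length = n + 1 := by have := hτ.2; omega
        refine ⟨hlen, fun x hx => h2 x (conv_face hτ hx), fun l hl => h3 l (hl.1.trans hτ.1) ?_⟩
        have := hl.2; omega)
      filter_upwards [this] with M hM
      rw [hM, ← bd_SdM, mapc_bd, Theta_bd]

theorem negBary : BaryMap (fun x : V => -x) := by
  have := baryMap_affine ((-LinearMap.id : V →ₗ[ℝ] V).toAffineMap)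
  exact this

theorem conv_neg (l : List V) : conv (l.map fun x => -x) = (fun x => -x) '' conv l := by
  have := conv_map ((-LinearMap.id : V →ₗ[ℝ] V).toAffineMap) l
  exact this

theorem conv_smul (r : ℝ) (l : List V) : conv (l.map fun x => r • x) = (fun x => r • x) '' conv l := by
  have := conv_map ((r • LinearMap.id : V →ₗ[ℝ] V).toAffineMap) l
  exact this

theorem Free_neg {G : C(V, Y)} {l : List V} (h : Free G l) : Free G (l.map fun x => -x) := by
  intro x hx
  rw [conv_neg] at hx
  obtain ⟨z, hz, rfl⟩ := hx
  simp only [neg_neg]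
  exact (h z hz).symm

theorem F4 (G : C(V, Y)) {u : V → ZMod 2} (hu : ∀ x, x ≠ 0 → u (-x) = u x + 1) {c : Ch V}
    (hc : c ∈ Sup {τ | τ.length = n + 1 ∧ Good n G τ ∧ (∀ l, IsFace l τ → Free G l) ∧ Pos τ}) :
    ∀ᶠ M in atTop, io n G u M (mapc (fun x => -x) c) = io n G u M c := by
  refine sup_ind (p := fun c => ∀ᶠ M in atTop, io n G u M (mapc (fun x => -x) c) = io n G u M c) ?_ ?_ ?_ hc
  · simp
  · intro a b ha hb
    filter_upwards [ha, hb] with M h1 h2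
    simp only [map_add, h1, h2]
  · rintro τ ⟨h1, h2 | ⟨y, h2⟩, h3, φ, hφ⟩
    · filter_upwards [F2 (n := n) G u (c := bs τ) (bs_mem h2),
        F2 (n := n) G u (c := bs (τ.map fun x => -x)) (bs_mem (Free_neg h2))] with M e1 e2
      rw [mapc_bs, e1, e2]
    · have a1 := F1 G u τ h1 y h2 h3
      have a2 := F1 G u (τ.map fun x => -x) (by simpa using h1) y (by
        intro x hx
        rw [conv_neg] at hx
        obtain ⟨z, hz, rfl⟩ := hx
        simp only [neg_neg]
        exact (h2 z hz).symm) (by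
        intro l hl
        obtain ⟨l', hl', rfl⟩ := isFace_map _ hl
        exact Free_neg (h3 l' hl'))
      filter_upwards [a1, a2] with M e1 e2
      rw [mapc_bs, e1, e2, ← mapc_bs, ← mapc_SdM negBary, mapc_mapc]
      rw [← Theta_sig (mapc (lab (Dy n y G) u) (SdM M (bs τ))), mapc_mapc]
      congr 1
      apply sd_congr
      intro x hx
      have hx0 : x ≠ 0 := by
        rintro rfl
        have := hφ 0 hx
        simp at this
      simp [lab, sigX, Dy_neg, hu x hx0]

theorem Good_ev (G : C(V, Y)) (B : ℝ) (c : Ch V) (hc : c ∈ Sup {l | conv l ⊆ Metric.closedBall 0 B}) :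
    ∀ᶠ N in atTop, SdM N c ∈ Sup {l | Good n G l} := by
  set K : Set V := Metric.closedBall 0 B
  have hK : IsCompact K := isCompact_closedBall 0 B
  set Ω : Option Y → Set V := fun o => o.elim {x | G x ≠ G (-x)}
    (fun y => {x | G x ∈ (chartAt (Eu n) y).source ∧ G (-x) ∈ (chartAt (Eu n) y).source}) with hΩ
  have hGn : Continuous fun x => G (-x) := G.continuous.comp continuous_neg
  obtain ⟨δ, hδ, hL⟩ := lebesgue_number_lemma_of_metric (c := Ω) hK (by
    rintro (_ | y)
    · exact isOpen_ne_fun G.continuous hGn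
    · exact ((chartAt (Eu n) y).open_source.preimage G.continuous).inter
        ((chartAt (Eu n) y).open_source.preimage hGn)) (by
    intro x _
    by_cases h : G x = G (-x)
    · refine Set.mem_iUnion.2 ⟨some (G x), ?_⟩
      have := mem_chart_source (Eu n) (G x)
      exact ⟨this, by rw [← h]; exact this⟩
    · exact Set.mem_iUnion.2 ⟨none, h⟩)
  filter_upwards [mesh_ev c (half_pos hδ)] with N hN
  refine sup_mono ?_ (sup_inter hN (SdM_sup (sdClosed_conv _) N hc))
  rintro l ⟨h1, h2⟩
  rcases l with _ | ⟨a, l⟩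
  · left; intro x hx; simp [conv] at hx
  · have ha : a ∈ conv (a :: l) := mem_conv (by simp)
    obtain ⟨o, ho⟩ := hL a (h2 ha)
    have hs : conv (a :: l) ⊆ Ω o := fun x hx => ho (by
      rw [Metric.mem_ball]
      exact (mesh_conv h1 hx ha).trans_lt (by linarith))
    rcases o with _ | y
    · left; exact fun x hx => hs hx
    · right; exact ⟨y, fun x hx => hs hx⟩

theorem isOpen_good (l : List V) : IsOpen {G : C(V, Y) | Good n G l} := by
  have : {G : C(V, Y) | Good n G l} = {G | Free G l} ∪ ⋃ y : Y, {G | In n y G l} := by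
    ext G; simp [Good]
  rw [this]
  exact (isOpen_free l).union (isOpen_iUnion fun y => isOpen_in y l)

theorem sdClosed_pos : SdClosed {l : List V | Pos l} := by
  rintro l ⟨φ, hφ⟩ l' _ h
  exact ⟨φ, fun x hx => hφ x (conv_mono h hx)⟩

theorem sup_bound (c : Ch V) : ∃ B : ℝ, 0 < B ∧ c ∈ Sup {l | conv l ⊆ Metric.closedBall 0 B} := by
  have hK : IsCompact (⋃ l ∈ c.support, conv l) := c.support.isCompact_biUnion fun l _ => conv_compact l
  obtain ⟨B, hB0, hB⟩ := hK.isBounded.subset_closedBall_lt 0 0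
  refine ⟨B, hB0, sup_mono ?_ (sup_supp c)⟩
  intro l hl
  exact (Set.subset_biUnion_of_mem (u := fun l => conv l) hl).trans hB

theorem sup_lower (c : Ch V) (hc : c ∈ Sup {l | conv l ⊆ {0}ᶜ}) :
    ∃ m : ℝ, 0 < m ∧ c ∈ Sup {l | ∀ x ∈ conv l, m ≤ ‖x‖} := by
  have hK : IsCompact (⋃ l ∈ c.support, conv l) := c.support.isCompact_biUnion fun l _ => conv_compact l
  rw [Sup, Finsupp.mem_supported] at hc
  have h0 : (0 : V) ∈ (⋃ l ∈ c.support, conv l)ᶜ := by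
    intro h
    obtain ⟨l, hl, hx⟩ := Set.mem_iUnion₂.1 h
    exact hc hl hx rfl
  obtain ⟨m, hm, hb⟩ := Metric.isOpen_iff.1 hK.isClosed.isOpen_compl 0 h0
  refine ⟨m, hm, sup_mono ?_ (sup_supp c)⟩
  intro l hl x hx
  by_contra hlt
  exact hb (mem_ball_zero_iff.2 (not_le.1 hlt)) (Set.mem_biUnion hl hx)

theorem sign_pos {b : Module.Basis (Fin (n + 1)) ℝ V} {is : List (Fin (n + 1))} (hn : is.Nodup) {l : List V}
    (h : SignOf l (is.map b)) : ∃ φ : V →ₗ[ℝ] ℝ, ∀ x ∈ l, φ x = 1 := sign_fun b hn h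

end
end CD

open scoped RealInnerProductSpace

namespace CD
noncomputable section
set_option linter.unusedSectionVars false

open Filter Topology

variable {n : ℕ}
variable {V : Type*} [NormedAddCommGroup V] [NormedSpace ℝ V] [FiniteDimensional ℝ V]
variable {Y : Type*} [TopologicalSpace Y] [T2Space Y] [ChartedSpace (Eu n) Y]

theorem sup_iff {c : Ch V} {S : Set (List V)} : c ∈ Sup S ↔ ∀ l ∈ c.support, l ∈ S := by
  rw [Sup, Finsupp.mem_supported]; rfl

theorem small_basis (hV : Module.finrank ℝ V = n + 1) {r : ℝ} (hr : 0 < r) :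
    ∃ b : Module.Basis (Fin (n + 1)) ℝ V, ∀ i, ‖b i‖ < r := by
  set b0 := Module.finBasisOfFinrankEq ℝ V hV
  set S : ℝ := ∑ i, ‖b0 i‖ with hS
  have hS0 : 0 ≤ S := Finset.sum_nonneg fun i _ => norm_nonneg _
  have hs : 0 < r / (1 + S) := by positivity
  refine ⟨b0.isUnitSMul (w := fun _ => r / (1 + S)) (fun _ => IsUnit.mk0 _ hs.ne'), ?_⟩
  intro i
  rw [Module.Basis.isUnitSMul_apply, norm_smul, Real.norm_of_nonneg hs.le, div_mul_eq_mul_div, div_lt_iff₀ (by positivity)]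
  have : ‖b0 i‖ ≤ S := Finset.single_le_sum (f := fun i => ‖b0 i‖) (fun i _ => norm_nonneg _) (Finset.mem_univ i)
  nlinarith

theorem pos_of {φ : V →ₗ[ℝ] ℝ} {l : List V} (h : ∀ x ∈ l, 0 < φ x) : Pos l := by
  refine ⟨φ, ?_⟩
  have h1 : conv l ⊆ {x | 0 < φ x} := conv_sub (convex_halfSpace_gt φ.isLinear 0) h
  exact h1

theorem half_len_pos (b : Module.Basis (Fin (n + 1)) ℝ V) {is : List (Fin (n + 1))} (hn : is.Nodup) :
    half (is.map b) ∈ Sup {l | l.length = is.length ∧ Pos l} := by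
  refine sup_mono ?_ (half_sup _)
  intro l hl
  obtain ⟨φ, hφ⟩ := sign_fun b hn hl
  refine ⟨by simpa using List.Forall₂.length_eq hl, pos_of (φ := φ) fun x hx => ?_⟩
  rw [hφ x hx]; exact one_pos

theorem pr_len_pos (b : Module.Basis (Fin (n + 1)) ℝ V) {is : List (Fin (n + 1))} (hn : is.Nodup) {ρ : ℝ} (hρ : 0 < ρ) :
    pr (fun x => x) (fun x => ρ • x) (half (is.map b)) ∈ Sup {l | l.length = is.length + 1 ∧ Pos l} := by
  refine pr_sup _ _ ?_ (half_sup _)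
  intro l hl l' h1 h2
  obtain ⟨φ, hφ⟩ := sign_fun b hn hl
  refine ⟨by have h3 := List.Forall₂.length_eq hl
             rw [List.length_map] at h3; omega, pos_of (φ := φ) fun x hx => ?_⟩
  obtain ⟨y, hy, rfl | rfl⟩ := h2 x hx
  · rw [hφ x hy]; exact one_pos
  · rw [map_smul, hφ y hy]; simpa using hρ

theorem sdClosed_len_pos (k : ℕ) : SdClosed {l : List V | l.length = k ∧ Pos l} := fun l hl l' h1 h2 =>
  ⟨sdClosed_len k l hl.1 l' h1 h2, sdClosed_pos l hl.2 l' h1 h2⟩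

theorem mapc_id (c : Ch V) : mapc (fun x => x) c = c := by
  have : mapc (fun x : V => x) = LinearMap.id := lin_ext fun l => by simp
  rw [this]; rfl

theorem A' (hn : 1 ≤ n) (hV : Module.finrank ℝ V = n + 1) (G : C(V, Y)) (R : ℝ)
    (hR : ∀ x, R ≤ ‖x‖ → G x ≠ G (-x)) : False := by
  classical
  set y0 := G 0 with hy0
  have hGn : Continuous fun x => G (-x) := G.continuous.comp continuous_neg
  have hW : IsOpen {x | G x ∈ (chartAt (Eu n) y0).source ∧ G (-x) ∈ (chartAt (Eu n) y0).source} :=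
    ((chartAt (Eu n) y0).open_source.preimage G.continuous).inter
        ((chartAt (Eu n) y0).open_source.preimage hGn)
  obtain ⟨r0, hr0, hr0W⟩ := Metric.isOpen_iff.1 hW 0
    ⟨mem_chart_source _ _, by rw [neg_zero]; exact mem_chart_source _ _⟩
  obtain ⟨b, hb⟩ := small_basis hV hr0
  set is : List (Fin (n + 1)) := (List.finRange n).map Fin.succ with his
  have hnd : (0 :: is).Nodup := by
    rw [his, ← List.finRange_succ]; exact List.nodup_finRange _
  have hnd' : is.Nodup := (List.nodup_cons.1 hnd).2
  have hni : (0 : Fin (n + 1)) ∉ is := (List.nodup_cons.1 hnd).1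
  have hlen : is.length = n := by simp [his]
  obtain ⟨j, js, hj⟩ : ∃ j js, is = j :: js := by
    cases h : is with
    | nil => rw [h] at hlen; simp at hlen; omega
    | cons j js => exact ⟨j, js, rfl⟩
  set h := half ((0 :: is).map b) with hh
  have hhemi : Hemi {l | conv l ⊆ {0}ᶜ} (fun x : V => -x) n h := by
    have := hemi_basis b hnd' 0 hni
    rwa [hlen] at this
  have hlp : h ∈ Sup {l | l.length = n + 1 ∧ Pos l} := by
    have := half_len_pos b hnd
    rwa [List.length_cons, hlen] at this
  obtain ⟨m, hm, hmS⟩ := sup_lower h (by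
    refine sup_mono ?_ hlp
    rintro l ⟨_, φ, hφ⟩ x hx h0
    have := hφ x hx
    rw [Set.mem_singleton_iff.1 h0] at this
    simp at this)
  set ρ : ℝ := max (|R| / m) 1 with hρd
  have hρ : 0 < ρ := lt_of_lt_of_le one_pos (le_max_right _ _)
  have hρm : R ≤ ρ * m := by
    have h1 : |R| / m ≤ ρ := le_max_left _ _
    rw [div_le_iff₀ hm] at h1
    exact (le_abs_self R).trans h1
  set o := mapc (fun x => ρ • x) h with ho
  set c0 := pr (fun x => x) (fun x => ρ • x) h with hc0
  set P := pr (fun x => x) (fun x => ρ • x) (half (is.map b)) with hP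
  have hbd : bd c0 = h + o + (P + mapc (fun x => -x) P) := by
    rw [hc0, bd_pr, mapc_id]
    congr 1
    rw [hh, List.map_cons, bd_half, hP]
    rw [pr_map (fun x => x) (fun x => ρ • x) (fun x => x) (fun x => ρ • x) (fun x : V => -x) (fun x : V => -x)
      (fun x => rfl) (fun x => (smul_neg ρ x).symm), ← map_add]
    rw [hj, List.map_cons, cross_eq]
  have hc0S : c0 ∈ Sup {l | l.length = n + 2 ∧ Pos l} := by
    have := pr_len_pos b hnd hρ
    rwa [List.length_cons, hlen] at this
  have hPS : P ∈ Sup {l | l.length = n + 1 ∧ Pos l} := by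
    have := pr_len_pos b hnd' hρ
    rwa [hlen] at this
  have hoS : o ∈ Sup {l | l.length = n + 1 ∧ Pos l} := by
    refine mapc_sup ?_ hlp
    rintro l ⟨h1, φ, hφ⟩
    refine ⟨by simpa using h1, φ, ?_⟩
    intro x hx
    rw [conv_smul] at hx
    obtain ⟨z, hz, rfl⟩ := hx
    rw [map_smul]
    exact mul_pos hρ (hφ z hz)
  have hoR : o ∈ Sup {l | conv l ⊆ {x | R ≤ ‖x‖}} := by
    refine mapc_sup ?_ hmS
    intro l hl x hx
    rw [conv_smul] at hx
    obtain ⟨z, hz, rfl⟩ := hx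
    show R ≤ ‖ρ • z‖
    rw [norm_smul, Real.norm_of_nonneg hρ.le]
    exact hρm.trans (mul_le_mul_of_nonneg_left (hl z hz) hρ.le)
  have hhW : h ∈ Sup {l | conv l ⊆ Metric.ball 0 r0} := by
    refine sup_mono ?_ (half_sup _)
    intro l hl
    refine conv_sub (convex_ball _ _) ?_
    intro x hx
    obtain ⟨y, hy, hxy⟩ := signOf_mem hl x hx
    obtain ⟨i, _, rfl⟩ := List.mem_map.1 hy
    rw [mem_ball_zero_iff]
    rcases hxy with rfl | rfl
    · exact hb i
    · rw [norm_neg]; exact hb i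
  obtain ⟨B1, -, hB1⟩ := sup_bound c0
  obtain ⟨B2, -, hB2⟩ := sup_bound P
  obtain ⟨N, hN1, hN2⟩ := ((Good_ev (n := n) G B1 c0 hB1).and (Good_ev (n := n) G B2 P hB2)).exists
  set c1 := SdM N c0 with hc1
  set P1 := SdM N P with hP1
  set h1 := SdM N h with hh1
  set o1 := SdM N o with ho1
  have k_c := sup_iff.1 (SdM_sup (sdClosed_len_pos _) N hc0S)
  have k_P := sup_iff.1 (SdM_sup (sdClosed_len_pos _) N hPS)
  have k_h := sup_iff.1 (SdM_sup (sdClosed_len_pos _) N hlp)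
  have k_o := sup_iff.1 (SdM_sup (sdClosed_len_pos _) N hoS)
  have g_h : ∀ l ∈ h1.support, In n y0 G l := by
    have := sup_iff.1 (SdM_sup (sdClosed_conv _) N hhW)
    exact fun l hl x hx => hr0W (this l hl hx)
  have g_o : ∀ l ∈ o1.support, Free G l := by
    have := sup_iff.1 (SdM_sup (sdClosed_conv _) N hoR)
    exact fun l hl x hx => hR x (this l hl hx)
  set L : Finset (List V) := c1.support ∪ P1.support ∪ h1.support ∪ o1.support with hL
  have hLg : ∀ l ∈ L, Good n G l := by
    intro l hl
    simp only [hL, Finset.mem_union] at hl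
    rcases hl with ((hl | hl) | hl) | hl
    · exact sup_iff.1 hN1 l hl
    · exact sup_iff.1 hN2 l hl
    · exact Or.inr ⟨y0, g_h l hl⟩
    · exact Or.inl (g_o l hl)
  have hLp : ∀ l ∈ L, Pos l := by
    intro l hl
    simp only [hL, Finset.mem_union] at hl
    rcases hl with ((hl | hl) | hl) | hl
    · exact (k_c l hl).2
    · exact (k_P l hl).2
    · exact (k_h l hl).2
    · exact (k_o l hl).2
  set O : Set C(V, Y) := (⋂ l ∈ L, {G | Good n G l}) ∩ ((⋂ l ∈ h1.support, {G | In n y0 G l}) ∩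
    ⋂ l ∈ o1.support, {G | Free G l}) with hO
  have hOo : IsOpen O := (isOpen_biInter_finset fun l _ => isOpen_good l).inter
    ((isOpen_biInter_finset fun l _ => isOpen_in y0 l).inter (isOpen_biInter_finset fun l _ => isOpen_free l))
  have hOm : ∀ G', G' ∈ O ↔ (∀ l ∈ L, Good n G' l) ∧ (∀ l ∈ h1.support, In n y0 G' l) ∧
      ∀ l ∈ o1.support, Free G' l := by
    intro G'
    simp only [hO, Set.mem_inter_iff, Set.mem_iInter₂, Set.mem_setOf_eq]
  have hGO : G ∈ O := (hOm G).2 ⟨hLg, g_h, g_o⟩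
  set T : List (List V) := L.toList.flatMap fun l => l.sublists.filter fun l' => l'.length = n with hT
  have hTm : ∀ l', l' ∈ T ↔ ∃ l ∈ L, l'.Sublist l ∧ l'.length = n := by
    intro l'
    simp [hT]
  obtain ⟨G', hG'O, hG'T⟩ := perturb (n := n) hOo ⟨G, hGO⟩ T (by
    intro l' hl'
    obtain ⟨l, hl, h3, h4⟩ := (hTm l').1 hl'
    have hcv : conv l' ⊆ conv l := conv_mono fun x hx => mem_conv (h3.subset hx)
    refine ⟨h4.le, ?_, ?_⟩
    · obtain ⟨φ, hφ⟩ := hLp l hl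
      exact ⟨φ, fun x hx => hφ x (hcv hx)⟩
    · intro G2 hG2
      exact Good_sub (((hOm G2).1 hG2).1 l hl) hcv)
  obtain ⟨q1, q2, q3⟩ := (hOm G').1 hG'O
  have hfree : ∀ l ∈ L, ∀ l' : List V, l'.Sublist l → l'.length = n → Free G' l' :=
    fun l hl l' h3 h4 => hG'T l' ((hTm l').2 ⟨l, hl, h3, h4⟩)
  obtain ⟨u, hu⟩ := exists_u V
  have m_c : ∀ l ∈ c1.support, l ∈ L := fun l hl => by simp only [hL, Finset.mem_union]; tauto
  have m_P : ∀ l ∈ P1.support, l ∈ L := fun l hl => by simp only [hL, Finset.mem_union]; tauto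
  have m_h : ∀ l ∈ h1.support, l ∈ L := fun l hl => by simp only [hL, Finset.mem_union]; tauto
  have m_o : ∀ l ∈ o1.support, l ∈ L := fun l hl => by simp only [hL, Finset.mem_union]; tauto
  have e_c := F3 (n := n) G' u (c := c1) (sup_iff.2 fun l hl =>
    ⟨(k_c l hl).1, q1 l (m_c l hl), fun l' => hfree l (m_c l hl) l'⟩)
  have e_h := F1s (n := n) G' u y0 (c := h1) (sup_iff.2 fun l hl =>
    ⟨(k_h l hl).1, q2 l hl, fun l' hl' => hfree l (m_h l hl) l' hl'.1 (by
      have := hl'.2; have := (k_h l hl).1; omega)⟩)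
  have e_o := F2 (n := n) G' u (c := o1) (sup_iff.2 fun l hl => q3 l hl)
  have e_P := F4 (n := n) G' hu (c := P1) (sup_iff.2 fun l hl =>
    ⟨(k_P l hl).1, q1 l (m_P l hl), fun l' hl' => hfree l (m_P l hl) l' hl'.1 (by
      have := hl'.2; have := (k_P l hl).1; omega), (k_P l hl).2⟩)
  obtain ⟨M, ⟨a1, a2⟩, a3, a4⟩ := ((e_c.and e_h).and (e_o.and e_P)).exists
  rw [hc1, bd_SdM, hbd] at a1
  simp only [map_add] at a1
  rw [← mapc_SdM negBary, a4, ch_add_self, add_zero, a3, add_zero, a2, hh1, ← SdM_add,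
    Theta_borsuk hhemi (Dy_neg y0 G') hu] at a1
  exact one_ne_zero a1

end
end CD

open scoped RealInnerProductSpace
namespace CD
noncomputable section
set_option linter.unusedSectionVars false
open Filter Topology

section geo
variable {E : Type*} [NormedAddCommGroup E] [InnerProductSpace ℝ E]

def gg (m : E) (s : ℝ) (v : E) : E := Real.cos (s * ‖v‖) • m + (s * Real.sinc (s * ‖v‖)) • v

lemma sinc_mul_self (x : ℝ) : Real.sinc x * x = Real.sin x := by
  by_cases h : x = 0
  · simp [h]
  · rw [Real.sinc_of_ne_zero h]; field_simp

lemma gg_inner {m v : E} (hm : ‖m‖ = 1) (hv : ⟪m, v⟫ = 0) (s t : ℝ) :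
    ⟪gg m s v, gg m t v⟫ = Real.cos ((s - t) * ‖v‖) := by
  have hv' : ⟪v, m⟫ = 0 := by rw [real_inner_comm]; exact hv
  have h1 := sinc_mul_self (s * ‖v‖)
  have h2 := sinc_mul_self (t * ‖v‖)
  unfold gg
  rw [sub_mul, Real.cos_sub, ← h1, ← h2]
  simp only [inner_add_left, inner_add_right, inner_smul_left, inner_smul_right, hv, hv',
    real_inner_self_eq_norm_sq, hm]
  simp
  ring

lemma gg_zero (m v : E) : gg m 0 v = m := by simp [gg]

lemma gg_neg (m v : E) (s : ℝ) : gg m s (-v) = gg m (-s) v := by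
  simp [gg, Real.sinc_neg]

lemma gg_norm {m v : E} (hm : ‖m‖ = 1) (hv : ⟪m, v⟫ = 0) (s : ℝ) : ‖gg m s v‖ = 1 := by
  have h := gg_inner hm hv s s
  rw [real_inner_self_eq_norm_sq] at h
  simp at h
  have h0 := norm_nonneg (gg m s v)
  rcases h with h | h
  · exact h
  · linarith

lemma gg_cont (m : E) {X : Type*} [TopologicalSpace X] {a : X → ℝ} {b : X → E}
    (ha : Continuous a) (hb : Continuous b) : Continuous fun x => gg m (a x) (b x) := by
  unfold gg
  have h : Continuous fun x => a x * ‖b x‖ := ha.mul hb.norm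
  exact ((Real.continuous_cos.comp h).smul continuous_const).add
    ((ha.mul (Real.continuous_sinc.comp h)).smul hb)

def vh (d : ℝ) (v : E) : E := (d / max d ‖v‖) • v

lemma vh_neg (d : ℝ) (v : E) : vh d (-v) = -vh d v := by simp [vh]

lemma vh_norm {d : ℝ} (hd : 0 < d) {v : E} (h : d ≤ ‖v‖) : ‖vh d v‖ = d := by
  have h0 : 0 < ‖v‖ := hd.trans_le h
  rw [vh, max_eq_right h, norm_smul, Real.norm_eq_abs, abs_of_pos (div_pos hd h0)]
  field_simp

lemma vh_cont {d : ℝ} (hd : 0 < d) : Continuous (vh d : E → E) := by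
  unfold vh
  refine Continuous.smul (Continuous.div continuous_const (continuous_const.max continuous_norm)
    fun v => ?_) continuous_id
  exact (lt_of_lt_of_le hd (le_max_left _ _)).ne'

lemma vh_inner {m v : E} (hv : ⟪m, v⟫ = 0) (d : ℝ) : ⟪m, vh d v⟫ = 0 := by
  simp [vh, inner_smul_right, hv]

end geo

lemma reduction {n : ℕ} (hn : 1 ≤ n) {Y : Type*} [TopologicalSpace Y] [T2Space Y]
    [ChartedSpace (EuclideanSpace ℝ (Fin n)) Y] [ConnectedSpace Y] (hY : ¬ CompactSpace Y)
    (f : EuclideanSpace ℝ (Fin (n + 1)) → Y) (hf : ContinuousOn f (Metric.sphere 0 1))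
    (δ : ℝ) (hδ0 : 0 < δ) (hδπ : δ ≤ Real.pi)
    (h : ∀ x y : EuclideanSpace ℝ (Fin (n + 1)), ‖x‖ = 1 → ‖y‖ = 1 → ⟪x, y⟫ = Real.cos δ →
      f x ≠ f y) : False := by
  set S : Set (EuclideanSpace ℝ (Fin (n + 1))) := Metric.sphere 0 1 with hS
  have hSc : IsCompact S := isCompact_sphere _ _
  have memS : ∀ x, x ∈ S ↔ ‖x‖ = 1 := fun x => by simp [hS]
  have hKc : IsCompact (f '' S) := hSc.image_of_continuousOn hf
  have hKne : f '' S ≠ Set.univ := fun e => hY ⟨e ▸ hKc⟩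
  have hKn : (f '' S).Nonempty := by
    refine Set.Nonempty.image f ⟨EuclideanSpace.single 0 1, ?_⟩
    rw [memS]; simp
  have hKo : ¬ IsOpen (f '' S) := by
    intro ho
    rcases isClopen_iff.1 ⟨hKc.isClosed, ho⟩ with e | e
    · exact hKn.ne_empty e
    · exact hKne e
  obtain ⟨q0, hq0, hq0'⟩ : ∃ q0 ∈ f '' S, q0 ∉ interior (f '' S) := by
    by_contra! hc
    exact hKo (interior_eq_iff_isOpen.1 (Set.Subset.antisymm interior_subset hc))
  obtain ⟨m, hmS, rfl⟩ := hq0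
  have hm : ‖m‖ = 1 := (memS m).1 hmS
  set T : Set (EuclideanSpace ℝ (Fin (n + 1))) := S ∩ {y | ⟪m, y⟫ = Real.cos δ} with hT
  have hTc : IsCompact T := hSc.inter_right
    (isClosed_eq (continuous_const.inner continuous_id) continuous_const)
  have hFc : IsClosed (f '' T) :=
    (hTc.image_of_continuousOn (hf.mono Set.inter_subset_left)).isClosed
  have hmF : f m ∈ (f '' T)ᶜ := by
    rintro ⟨y, ⟨hy1, hy2⟩, hy3⟩
    exact h m y hm ((memS y).1 hy1) hy2 hy3.symm
  haveI := ChartedSpace.locallyPathConnectedSpace (EuclideanSpace ℝ (Fin n)) Y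
  have hPo : IsOpen (pathComponentIn (f '' T)ᶜ (f m)) := hFc.isOpen_compl.pathComponentIn _
  obtain ⟨q1, hq1, hq1K⟩ : ∃ q1 ∈ pathComponentIn (f '' T)ᶜ (f m), q1 ∉ f '' S := by
    by_contra! hc
    exact hq0' (interior_maximal hc hPo (mem_pathComponentIn_self hmF))
  obtain ⟨γ, hγ⟩ : JoinedIn (f '' T)ᶜ (f m) q1 := hq1
  have hγe : ∀ t, γ.extend t ∉ f '' T := by
    intro t
    have : γ.extend t ∈ Set.range γ := by
      rw [← Path.extend_range γ]; exact Set.mem_range_self t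
    obtain ⟨s, hs⟩ := this
    rw [← hs]; exact hγ s
  -- the vector space
  have hmne : m ≠ 0 := by rintro rfl; simp at hm
  haveI : Fact (Module.finrank ℝ (EuclideanSpace ℝ (Fin (n + 1))) = n + 1) := ⟨by simp⟩
  let W := (ℝ ∙ m)ᗮ
  have hW : Module.finrank ℝ W = n := Submodule.finrank_orthogonal_span_singleton hmne
  have hV : Module.finrank ℝ (ℝ × W) = n + 1 := by
    rw [Module.finrank_prod, hW]; simp [add_comm]
  have hperp : ∀ v : W, ⟪m, (v : EuclideanSpace ℝ (Fin (n + 1)))⟫ = 0 := fun v =>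
    Submodule.mem_orthogonal_singleton_iff_inner_right.1 v.2
  have hd : 0 < δ / 2 := by positivity
  let c : ℝ → ℝ := fun u => max (-1) (min 1 u)
  let P : ℝ × W → EuclideanSpace ℝ (Fin (n + 1)) :=
    fun x => gg m (c x.1 - 1) (vh (δ / 2) (x.2 : EuclideanSpace ℝ (Fin (n + 1))))
  have hP : Continuous P := by
    refine gg_cont m ?_ ((vh_cont hd).comp (continuous_subtype_val.comp continuous_snd))
    exact (continuous_const.max (continuous_const.min continuous_fst)).sub continuous_const
  have hPS : ∀ x, P x ∈ S := fun x => (memS _).2 (gg_norm hm (vh_inner (hperp _) _) _)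
  have hfP : Continuous fun x => f (P x) := hf.comp_continuous hP hPS
  let G0 : ℝ × W → Y := fun x => if x.1 ≤ 1 then f (P x) else γ.extend (x.1 - 1)
  have hG0 : Continuous G0 := by
    refine Continuous.if_le hfP (γ.continuous_extend.comp (continuous_fst.sub continuous_const))
      continuous_fst continuous_const ?_
    intro x hx
    have : P x = m := by
      simp only [P, c, hx]
      norm_num [gg_zero]
    simp [this, hx]
  have key : ∀ x : ℝ × W, 0 ≤ x.1 → (2 ≤ x.1 ∨ δ / 2 ≤ ‖x.2‖) → G0 x ≠ G0 (-x) := by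
    rintro ⟨u, v⟩ hu hx
    simp only at hu hx
    have hneg : G0 (-(u, v)) = f (P (-(u, v))) := by
      simp only [G0]; rw [if_pos]; simp; linarith
    have hPneg : P (-(u, v)) =
        gg m (min 1 u + 1) (vh (δ / 2) (v : EuclideanSpace ℝ (Fin (n + 1)))) := by
      simp only [P, c, Prod.fst_neg, Prod.snd_neg, Submodule.coe_neg, vh_neg, gg_neg]
      congr 1
      rcases le_total u 1 with h1 | h1
      · rw [min_eq_right h1, min_eq_right (by linarith), max_eq_right (by linarith)]; ring
      · rw [min_eq_left h1, min_eq_right (by linarith), max_eq_left (by linarith)]; ring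
    rw [hneg]
    have hp := vh_inner (hperp v) (δ / 2)
    rcases le_or_gt u 1 with h1 | h1
    · have hv : δ / 2 ≤ ‖(v : EuclideanSpace ℝ (Fin (n + 1)))‖ := by
        rcases hx with hx | hx
        · linarith
        · exact hx
      have e1 : G0 (u, v) = f (P (u, v)) := by simp only [G0]; rw [if_pos h1]
      have e2 : P (u, v) = gg m (u - 1) (vh (δ / 2) (v : EuclideanSpace ℝ (Fin (n + 1)))) := by
        simp only [P, c]; rw [min_eq_right h1, max_eq_right (by linarith)]
      rw [e1]
      refine h _ _ ((memS _).1 (hPS _)) ((memS _).1 (hPS _)) ?_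
      rw [e2, hPneg, min_eq_right h1, gg_inner hm hp, vh_norm hd hv, ← Real.cos_neg]
      congr 1; ring
    · have e1 : G0 (u, v) = γ.extend (u - 1) := by simp only [G0]; rw [if_neg (not_le.2 h1)]
      rw [e1]
      rcases hx with hx | hx
      · rw [γ.extend_of_one_le (by linarith)]
        intro e
        exact hq1K (e ▸ Set.mem_image_of_mem f (hPS _))
      · intro e
        refine hγe (u - 1) (e ▸ Set.mem_image_of_mem f ⟨hPS _, ?_⟩)
        have hv : δ / 2 ≤ ‖(v : EuclideanSpace ℝ (Fin (n + 1)))‖ := hx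
        have := gg_inner hm hp 0 2
        rw [gg_zero, vh_norm hd hv, ← Real.cos_neg] at this
        rw [Set.mem_setOf_eq, hPneg, min_eq_left h1.le]
        norm_num at this ⊢
        rw [this]; congr 1; ring
  refine A' hn hV ⟨G0, hG0⟩ (max 2 (δ / 2)) ?_
  intro x hx
  have hx' : 2 ≤ |x.1| ∨ δ / 2 ≤ ‖x.2‖ := by
    rw [Prod.norm_def, le_max_iff] at hx
    rcases hx with hx | hx
    · exact Or.inl ((le_max_left _ _).trans hx)
    · exact Or.inr ((le_max_right _ _).trans hx)
  show G0 x ≠ G0 (-x)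
  rcases le_total 0 x.1 with h0 | h0
  · rw [abs_of_nonneg h0] at hx'
    exact key x h0 hx'
  · rw [abs_of_nonpos h0] at hx'
    have := key (-x) (by simpa using h0) (by simpa using hx')
    rw [neg_neg] at this
    exact this.symm

end
end CD


open scoped RealInnerProductSpace

/-- Let `n ≥ 1`, let `Y` be a connected, non-compact, Hausdorff topological manifold
modelled on `ℝ^n`, let `f : S^n → Y` be continuous, and let `0 < δ ≤ π`. Then there
exist points `x, y ∈ S^n` at geodesic distance exactly `δ` (i.e. `arccos ⟪x,y⟫ = δ`)
with `f x = f y`. -/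
theorem coincidence_at_distance_delta_sphere_to_open_manifold
    (n : ℕ) (hn : 1 ≤ n)
    (Y : Type*) [TopologicalSpace Y] [T2Space Y]
    [ChartedSpace (EuclideanSpace ℝ (Fin n)) Y]
    [ConnectedSpace Y] (hY : ¬ CompactSpace Y)
    (f : EuclideanSpace ℝ (Fin (n + 1)) → Y)
    (hf : ContinuousOn f (Metric.sphere 0 1))
    (δ : ℝ) (hδ0 : 0 < δ) (hδπ : δ ≤ Real.pi) :
    ∃ x y : EuclideanSpace ℝ (Fin (n + 1)), ‖x‖ = 1 ∧ ‖y‖ = 1 ∧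
      Real.arccos ⟪x, y⟫ = δ ∧ f x = f y := by

  by_contra! hc
  refine CD.reduction hn hY f hf δ hδ0 hδπ ?_
  intro x y hx hy hxy
  refine hc x y hx hy ?_
  rw [hxy, Real.arccos_cos hδ0.le hδπ]
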